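/- Suppose in addition that R is Henselian. Let μ : M → X be a homomorphism of finitely generated R-modules with X maximal Cohen–Macaulay. Then μ is a CM-envelope of M if and only if cod(ker μ) > 0, Ext^1_R(coker μ, Z) = 0 for every maximal Cohen–Macaulay R-module Z, and coker(μ†† : M†† → X††) has no nonzero free direct summand. -/

import Mathlib

open CategoryTheory

noncomputable section

/-- `Ext^n_A(M, N)` as a module. -/
def ext1 (A : Type) [CommRing A] (n : ℕ) (M N : Type) [AddCommGroup M] [Module A M]
    [AddCommGroup N] [Module A N] : ModuleCat A :=
  ((Ext A (ModuleCat A) n).obj (Opposite.op (ModuleCat.of A M))).obj (ModuleCat.of A N)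

/-- The depth of a module over a local ring: the least `n` with `Ext^n(k, M) ≠ 0`
(`⊤` if no such `n`, e.g. for the zero module). -/
def rdepth (A : Type) [CommRing A] [IsLocalRing A] (M : Type) [AddCommGroup M] [Module A M] :
    ℕ∞ :=
  sInf {n : ℕ∞ | ∃ m : ℕ, n = m ∧ ¬ Subsingleton (ext1 A m (IsLocalRing.ResidueField A) M)}

/-- The dimension of a module, `dim M = dim (A / ann M)`. -/
def mdim (A : Type) [CommRing A] (M : Type) [AddCommGroup M] [Module A M] : WithBot ℕ∞ :=
  ringKrullDim (A ⧸ Module.annihilator A M)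

/-- `cod M > n`, i.e. `dim A - dim M > n`, i.e. `dim M + n < d`. -/
def codGT (A : Type) [CommRing A] (d : ℕ) (M : Type) [AddCommGroup M] [Module A M]
    (n : ℕ) : Prop :=
  mdim A M + n < (d : WithBot ℕ∞)

/-- `cod M ≥ n`, i.e. `dim M + n ≤ d`. -/
def codGE (A : Type) [CommRing A] (d : ℕ) (M : Type) [AddCommGroup M] [Module A M]
    (n : ℕ) : Prop :=
  mdim A M + n ≤ (d : WithBot ℕ∞)

/-- Maximal Cohen-Macaulay module over a `d`-dimensional local ring
(the zero module counts as MCM). -/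
def IsMCM (A : Type) [CommRing A] [IsLocalRing A] (d : ℕ) (M : Type) [AddCommGroup M]
    [Module A M] : Prop :=
  Module.Finite A M ∧ (d : ℕ∞) ≤ rdepth A M

/-- Serre's condition `(S_n)`: `depth M_p ≥ min {n, ht p}` for all primes `p`. -/
def SerreS (A : Type) [CommRing A] (n : ℕ) (M : Type) [AddCommGroup M] [Module A M] : Prop :=
  ∀ p : PrimeSpectrum A,
    min (n : WithBot ℕ∞) (ringKrullDim (Localization.AtPrime p.asIdeal))
      ≤ (rdepth (Localization.AtPrime p.asIdeal)
          (LocalizedModule p.asIdeal.primeCompl M) : ℕ∞)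

/-- Finite injective dimension: `Ext^m(-, M)` vanishes for all large `m`. -/
def HasFID (A : Type) [CommRing A] (M : Type) [AddCommGroup M] [Module A M] : Prop :=
  ∃ n : ℕ, ∀ (N : Type) [AddCommGroup N] [Module A N], ∀ m : ℕ, n < m →
    Subsingleton (ext1 A m N M)

/-- `ω` is a canonical module of the `d`-dimensional local ring `A`:
it is maximal Cohen-Macaulay, of finite injective dimension, and of type one. -/
def IsCanonicalModule (A : Type) [CommRing A] [IsLocalRing A] (d : ℕ) (ω : Type)
    [AddCommGroup ω] [Module A ω] : Prop :=
  IsMCM A d ω ∧ HasFID A ω ∧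
    Nonempty ((ext1 A d (IsLocalRing.ResidueField A) ω) ≃ₗ[A] IsLocalRing.ResidueField A)

/-- `μ : M → X` is a CM-preenvelope. -/
def IsCMPreenvelope (A : Type) [CommRing A] [IsLocalRing A] (d : ℕ) {M X : Type}
    [AddCommGroup M] [Module A M] [AddCommGroup X] [Module A X] (μ : M →ₗ[A] X) : Prop :=
  IsMCM A d X ∧ ∀ (Z : Type) [AddCommGroup Z] [Module A Z], IsMCM A d Z →
    ∀ f : M →ₗ[A] Z, ∃ g : X →ₗ[A] Z, g ∘ₗ μ = f

/-- `μ : M → X` is a special CM-preenvelope: a CM-preenvelope with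
`Ext^1(coker μ, Z) = 0` for all maximal Cohen-Macaulay `Z`. -/
def IsSpecialCMPreenvelope (A : Type) [CommRing A] [IsLocalRing A] (d : ℕ) {M X : Type}
    [AddCommGroup M] [Module A M] [AddCommGroup X] [Module A X] (μ : M →ₗ[A] X) : Prop :=
  IsCMPreenvelope A d μ ∧ ∀ (Z : Type) [AddCommGroup Z] [Module A Z], IsMCM A d Z →
    Subsingleton (ext1 A 1 (X ⧸ LinearMap.range μ) Z)

/-- `μ : M → X` is a CM-envelope. -/
def IsCMEnvelope (A : Type) [CommRing A] [IsLocalRing A] (d : ℕ) {M X : Type}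
    [AddCommGroup M] [Module A M] [AddCommGroup X] [Module A X] (μ : M →ₗ[A] X) : Prop :=
  IsCMPreenvelope A d μ ∧ ∀ φ : X →ₗ[A] X, φ ∘ₗ μ = μ → Function.Bijective φ

/-- `π : X → M` is a CM-precover. -/
def IsCMPrecover (A : Type) [CommRing A] [IsLocalRing A] (d : ℕ) {X M : Type}
    [AddCommGroup X] [Module A X] [AddCommGroup M] [Module A M] (π : X →ₗ[A] M) : Prop :=
  IsMCM A d X ∧ ∀ (Z : Type) [AddCommGroup Z] [Module A Z], IsMCM A d Z →
    ∀ f : Z →ₗ[A] M, ∃ g : Z →ₗ[A] X, π ∘ₗ g = f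

/-- `π : X → M` is a special CM-precover: a CM-precover with
`Ext^1(Z, ker π) = 0` for all maximal Cohen-Macaulay `Z`. -/
def IsSpecialCMPrecover (A : Type) [CommRing A] [IsLocalRing A] (d : ℕ) {X M : Type}
    [AddCommGroup X] [Module A X] [AddCommGroup M] [Module A M] (π : X →ₗ[A] M) : Prop :=
  IsCMPrecover A d π ∧ ∀ (Z : Type) [AddCommGroup Z] [Module A Z], IsMCM A d Z →
    Subsingleton (ext1 A 1 Z ↥(LinearMap.ker π))

/-- `π : X → M` is a CM-cover. -/
def IsCMCover (A : Type) [CommRing A] [IsLocalRing A] (d : ℕ) {X M : Type}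
    [AddCommGroup X] [Module A X] [AddCommGroup M] [Module A M] (π : X →ₗ[A] M) : Prop :=
  IsCMPrecover A d π ∧ ∀ φ : X →ₗ[A] X, π ∘ₗ φ = π → Function.Bijective φ

/-- `M` has no nonzero free direct summand. -/
def NoNonzeroFreeSummand (A : Type) [CommRing A] (M : Type) [AddCommGroup M]
    [Module A M] : Prop :=
  ∀ F G : Submodule A M, IsCompl F G → Module.Free A ↥F → F = ⊥

/-- `W` belongs to `add ω`: it is a direct summand of a finite direct sum of copies of `ω`. -/
def InAdd (A : Type) [CommRing A] (ω : Type) [AddCommGroup ω] [Module A ω] (W : Type)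
    [AddCommGroup W] [Module A W] : Prop :=
  ∃ (n : ℕ) (W' : ModuleCat.{0} A), Nonempty ((W × ↥W') ≃ₗ[A] (Fin n → ω))

section delta

variable (A : Type) [CommRing A] (ω : Type) [AddCommGroup ω] [Module A ω]

/-- The natural evaluation map `δ_M : M → M†† = Hom(Hom(M, ω), ω)`. -/
def deltaMap (M : Type) [AddCommGroup M] [Module A M] :
    M →ₗ[A] ((M →ₗ[A] ω) →ₗ[A] ω) :=
  (LinearMap.id : (M →ₗ[A] ω) →ₗ[A] (M →ₗ[A] ω)).flip

/-- The dual `f† = Hom(f, ω)` of a linear map `f`. -/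
def dmap {M N : Type} [AddCommGroup M] [Module A M] [AddCommGroup N] [Module A N]
    (f : M →ₗ[A] N) : (N →ₗ[A] ω) →ₗ[A] (M →ₗ[A] ω) :=
  LinearMap.lcomp A ω f

end delta

/-- The homology `ker g / im f` at the middle spot of `M → N → P`. -/
abbrev homMod (A : Type) [CommRing A] {M N P : Type} [AddCommGroup M] [Module A M]
    [AddCommGroup N] [Module A N] [AddCommGroup P] [Module A P]
    (f : M →ₗ[A] N) (g : N →ₗ[A] P) : Type :=
  ↥(LinearMap.ker g) ⧸ Submodule.comap (LinearMap.ker g).subtype (LinearMap.range f)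

end

open CategoryTheory Abelian

section ExtModules

variable {R : Type} [CommRing R]

/-- `Ext` groups of modules, in the derived-category incarnation. -/
abbrev MExt (R : Type) [CommRing R] (M N : Type) [AddCommGroup M] [Module R M]
    [AddCommGroup N] [Module R N] (n : ℕ) : Type :=
  Abelian.Ext.{0} (ModuleCat.of R M) (ModuleCat.of R N) n

variable {A B C N : Type} [AddCommGroup A] [Module R A] [AddCommGroup B] [Module R B]
  [AddCommGroup C] [Module R C] [AddCommGroup N] [Module R N]

/-- `Ext` is contravariant in the first variable. -/
noncomputable def MExt.pre (f : A →ₗ[R] B) (N : Type) [AddCommGroup N] [Module R N] (n : ℕ) :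
    MExt R B N n →ₗ[R] MExt R A N n where
  toFun x := (Ext.mk₀ (ModuleCat.ofHom f)).comp x (zero_add n)
  map_add' := by simp
  map_smul' := by simp

/-- `Ext` is covariant in the second variable. -/
noncomputable def MExt.post (f : A →ₗ[R] B) (N : Type) [AddCommGroup N] [Module R N] (n : ℕ) :
    MExt R N A n →ₗ[R] MExt R N B n where
  toFun x := x.comp (Ext.mk₀ (ModuleCat.ofHom f)) (add_zero n)
  map_add' := by simp
  map_smul' := by simp

/-- `Ext` in degree zero is `Hom`. -/
noncomputable def MExt.zeroEquiv (M N : Type) [AddCommGroup M] [Module R M]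
    [AddCommGroup N] [Module R N] : MExt R M N 0 ≃ₗ[R] (M →ₗ[R] N) :=
  Ext.linearEquiv₀.trans ModuleCat.homLinearEquiv

lemma MExt.zeroEquiv_symm_apply (f : A →ₗ[R] N) :
    (MExt.zeroEquiv A N).symm f = Ext.mk₀ (ModuleCat.ofHom f) := rfl

lemma MExt.pre_zeroEquiv_symm (f : A →ₗ[R] B) (g : B →ₗ[R] N) :
    MExt.pre f N 0 ((MExt.zeroEquiv B N).symm g) = (MExt.zeroEquiv A N).symm (g ∘ₗ f) := by
  simp [zeroEquiv_symm_apply, pre, Ext.mk₀_comp_mk₀]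

lemma MExt.post_zeroEquiv_symm (f : N →ₗ[R] A) (g : A →ₗ[R] B) :
    MExt.post g N 0 ((MExt.zeroEquiv N A).symm f) = (MExt.zeroEquiv N B).symm (g ∘ₗ f) := by
  simp [zeroEquiv_symm_apply, post, Ext.mk₀_comp_mk₀]

lemma MExt.pre_comp (f : A →ₗ[R] B) (g : B →ₗ[R] C) (n : ℕ) (x : MExt R C N n) :
    MExt.pre (g ∘ₗ f) N n x = MExt.pre f N n (MExt.pre g N n x) := by
  simp [pre, ModuleCat.ofHom_comp]

lemma MExt.post_comp (f : A →ₗ[R] B) (g : B →ₗ[R] C) (n : ℕ) (x : MExt R N A n) :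
    MExt.post (g ∘ₗ f) N n x = MExt.post g N n (MExt.post f N n x) := by
  simp [post, ModuleCat.ofHom_comp]

lemma MExt.pre_id (n : ℕ) (x : MExt R A N n) : MExt.pre LinearMap.id N n x = x := by
  simp [pre]

lemma MExt.post_id (n : ℕ) (x : MExt R N A n) : MExt.post LinearMap.id N n x = x := by
  simp [post]

lemma MExt.pre_add (f g : A →ₗ[R] B) (n : ℕ) (x : MExt R B N n) :
    MExt.pre (f + g) N n x = MExt.pre f N n x + MExt.pre g N n x := by
  simp [pre, Ext.mk₀_add]

lemma MExt.pre_smul (r : R) (f : A →ₗ[R] B) (n : ℕ) (x : MExt R B N n) :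
    MExt.pre (r • f) N n x = r • MExt.pre f N n x := by
  have : ModuleCat.ofHom (r • f) = r • ModuleCat.ofHom f := rfl
  simp [pre, this, Ext.mk₀_smul]

lemma MExt.post_smul (r : R) (f : A →ₗ[R] B) (n : ℕ) (x : MExt R N A n) :
    MExt.post (r • f) N n x = r • MExt.post f N n x := by
  have : ModuleCat.ofHom (r • f) = r • ModuleCat.ofHom f := rfl
  simp [post, this, Ext.mk₀_smul]

lemma MExt.post_add (f g : A →ₗ[R] B) (n : ℕ) (x : MExt R N A n) :
    MExt.post (f + g) N n x = MExt.post f N n x + MExt.post g N n x := by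
  simp [post, Ext.mk₀_add]

/-- An isomorphism of first arguments induces an isomorphism on `Ext`. -/
noncomputable def MExt.preEquiv (e : A ≃ₗ[R] B) (N : Type) [AddCommGroup N] [Module R N] (n : ℕ) :
    MExt R B N n ≃ₗ[R] MExt R A N n :=
  LinearEquiv.ofLinearMap (MExt.pre e.toLinearMap N n) (MExt.pre e.symm.toLinearMap N n)
    (by ext x; simp [← MExt.pre_comp, MExt.pre_id]) (by ext x; simp [← MExt.pre_comp, MExt.pre_id])

/-- An isomorphism of second arguments induces an isomorphism on `Ext`. -/
noncomputable def MExt.postEquiv (e : A ≃ₗ[R] B) (N : Type) [AddCommGroup N] [Module R N]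
    (n : ℕ) : MExt R N A n ≃ₗ[R] MExt R N B n :=
  LinearEquiv.ofLinearMap (MExt.post e.toLinearMap N n) (MExt.post e.symm.toLinearMap N n)
    (by ext x; simp [← MExt.post_comp, MExt.post_id])
    (by ext x; simp [← MExt.post_comp, MExt.post_id])

section LongExact

variable {f : A →ₗ[R] B} {g : B →ₗ[R] C} (hf : Function.Injective f)
  (hg : Function.Surjective g) (h : Function.Exact f g)

include hf hg h

lemma shortExact_of_linearMap : ∃ w, (ShortComplex.mk (ModuleCat.ofHom f) (ModuleCat.ofHom g)
    w).ShortExact := by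
  have w : ModuleCat.ofHom f ≫ ModuleCat.ofHom g = 0 := by
    ext x
    simpa using h.apply_apply_eq_zero x
  refine ⟨w, ?_⟩
  have := (ModuleCat.mono_iff_injective (ModuleCat.ofHom f)).2 hf
  have := (ModuleCat.epi_iff_surjective (ModuleCat.ofHom g)).2 hg
  exact { exact := (ShortComplex.ShortExact.moduleCat_exact_iff_function_exact _).2 h }

lemma MExt.pre_exact (N : Type) [AddCommGroup N] [Module R N] (n : ℕ) :
    Function.Exact (MExt.pre g N n) (MExt.pre f N n) := by
  obtain ⟨w, hS⟩ := shortExact_of_linearMap hf hg h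
  intro x
  refine ⟨fun hx => Ext.contravariant_sequence_exact₂ hS _ x hx, ?_⟩
  rintro ⟨y, rfl⟩
  rw [← MExt.pre_comp, h.linearMap_comp_eq_zero]
  simp [pre]

lemma MExt.post_exact (N : Type) [AddCommGroup N] [Module R N] (n : ℕ) :
    Function.Exact (MExt.post f N n) (MExt.post g N n) := by
  obtain ⟨w, hS⟩ := shortExact_of_linearMap hf hg h
  intro x
  refine ⟨fun hx => Ext.covariant_sequence_exact₂ _ hS x hx, ?_⟩
  rintro ⟨y, rfl⟩
  rw [← MExt.post_comp, h.linearMap_comp_eq_zero]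
  simp [post]

lemma MExt.exists_pre_delta (N : Type) [AddCommGroup N] [Module R N] (n : ℕ) :
    ∃ δ : MExt R A N n →ₗ[R] MExt R C N (n + 1),
      Function.Exact (MExt.pre f N n) δ ∧ Function.Exact δ (MExt.pre g N (n + 1)) := by
  obtain ⟨w, hS⟩ := shortExact_of_linearMap hf hg h
  refine ⟨{ toFun := fun x => hS.extClass.comp x (add_comm 1 n)
            map_add' := by simp
            map_smul' := by simp }, fun x => ⟨fun hx => ?_, ?_⟩, fun x => ⟨fun hx => ?_, ?_⟩⟩
  · exact Ext.contravariant_sequence_exact₁ hS _ x (add_comm 1 n) hx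
  · rintro ⟨y, rfl⟩
    exact hS.extClass_comp_assoc y (h := add_comm 1 n)
  · exact Ext.contravariant_sequence_exact₃ hS _ x hx (add_comm 1 n)
  · rintro ⟨y, rfl⟩
    exact hS.comp_extClass_assoc y (add_comm 1 n)

lemma MExt.exists_post_delta (N : Type) [AddCommGroup N] [Module R N] (n : ℕ) :
    ∃ δ : MExt R N C n →ₗ[R] MExt R N A (n + 1),
      Function.Exact (MExt.post g N n) δ ∧ Function.Exact δ (MExt.post f N (n + 1)) := by
  obtain ⟨w, hS⟩ := shortExact_of_linearMap hf hg h
  refine ⟨{ toFun := fun x => x.comp hS.extClass rfl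
            map_add' := by simp
            map_smul' := by simp }, fun x => ⟨fun hx => ?_, ?_⟩, fun x => ⟨fun hx => ?_, ?_⟩⟩
  · exact Ext.covariant_sequence_exact₃ _ hS x rfl hx
  · rintro ⟨y, rfl⟩
    simpa [post, Ext.comp_assoc_of_second_deg_zero] using
      (congrArg (y.comp · rfl) hS.comp_extClass).trans (Ext.comp_zero ..)
  · exact Ext.covariant_sequence_exact₁ _ hS x hx rfl
  · rintro ⟨y, rfl⟩
    simpa [post] using
      (congrArg (y.comp · rfl) hS.extClass_comp).trans (Ext.comp_zero ..)

/-- Dévissage in the first variable. -/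
lemma MExt.subsingleton_middle_left {n : ℕ} (h₁ : Subsingleton (MExt R A N n))
    (h₃ : Subsingleton (MExt R C N n)) : Subsingleton (MExt R B N n) := by
  refine subsingleton_of_forall_eq 0 fun x => ?_
  obtain ⟨y, rfl⟩ := (MExt.pre_exact hf hg h N n x).1 (Subsingleton.elim _ _)
  rw [Subsingleton.elim y 0, map_zero]

/-- Dévissage in the second variable. -/
lemma MExt.subsingleton_middle_right {n : ℕ} (h₁ : Subsingleton (MExt R N A n))
    (h₃ : Subsingleton (MExt R N C n)) : Subsingleton (MExt R N B n) := by
  refine subsingleton_of_forall_eq 0 fun x => ?_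
  obtain ⟨y, rfl⟩ := (MExt.post_exact hf hg h N n x).1 (Subsingleton.elim _ _)
  rw [Subsingleton.elim y 0, map_zero]

lemma MExt.subsingleton_of_left_left {n : ℕ} (h₁ : Subsingleton (MExt R A N n))
    (h₂ : Subsingleton (MExt R B N (n + 1))) : Subsingleton (MExt R C N (n + 1)) := by
  obtain ⟨δ, -, h'⟩ := MExt.exists_pre_delta hf hg h N n
  refine subsingleton_of_forall_eq 0 fun x => ?_
  obtain ⟨y, rfl⟩ := (h' x).1 (Subsingleton.elim _ _)
  rw [Subsingleton.elim y 0, map_zero]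

lemma MExt.subsingleton_of_right_left {n : ℕ} (h₂ : Subsingleton (MExt R B N n))
    (h₃ : Subsingleton (MExt R C N (n + 1))) : Subsingleton (MExt R A N n) := by
  obtain ⟨δ, h', -⟩ := MExt.exists_pre_delta hf hg h N n
  refine subsingleton_of_forall_eq 0 fun x => ?_
  obtain ⟨y, rfl⟩ := (h' x).1 (Subsingleton.elim _ _)
  rw [Subsingleton.elim y 0, map_zero]

lemma MExt.subsingleton_of_left_right {n : ℕ} (h₁ : Subsingleton (MExt R N A (n + 1)))
    (h₂ : Subsingleton (MExt R N B n)) : Subsingleton (MExt R N C n) := by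
  obtain ⟨δ, h', -⟩ := MExt.exists_post_delta hf hg h N n
  refine subsingleton_of_forall_eq 0 fun x => ?_
  obtain ⟨y, rfl⟩ := (h' x).1 (Subsingleton.elim _ _)
  rw [Subsingleton.elim y 0, map_zero]

lemma MExt.subsingleton_of_right_right {n : ℕ} (h₂ : Subsingleton (MExt R N B (n + 1)))
    (h₃ : Subsingleton (MExt R N C n)) : Subsingleton (MExt R N A (n + 1)) := by
  obtain ⟨δ, -, h'⟩ := MExt.exists_post_delta hf hg h N n
  refine subsingleton_of_forall_eq 0 fun x => ?_
  obtain ⟨y, rfl⟩ := (h' x).1 (Subsingleton.elim _ _)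
  rw [Subsingleton.elim y 0, map_zero]

omit hg h in
lemma MExt.post_zero_injective (N : Type) [AddCommGroup N] [Module R N] :
    Function.Injective (MExt.post f N 0) := by
  have := (ModuleCat.mono_iff_injective (ModuleCat.ofHom f)).2 hf
  exact Ext.postcomp_mk₀_injective_of_mono _ (ModuleCat.ofHom f)

end LongExact

lemma MExt.subsingleton_of_projective [Module.Projective R A] (n : ℕ) :
    Subsingleton (MExt R A N (n + 1)) := by
  have : Projective (ModuleCat.of R A) := (IsProjective.iff_projective A).1 inferInstance
  exact Ext.subsingleton_of_projective _ _ _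

end ExtModules

section Bridge

open ProjectiveResolution

variable {R : Type} [CommRing R]

lemma extMk_smul {X Y : ModuleCat R} (P : ProjectiveResolution X) {n : ℕ} (r : R)
    (f : P.complex.X n ⟶ Y) (hf : P.complex.d (n + 1) n ≫ f = 0) :
    P.extMk (r • f) (n + 1) rfl (by simp [hf]) = r • P.extMk f (n + 1) rfl hf := by
  rw [Ext.smul_eq_comp_mk₀, P.extMk_comp_mk₀]
  congr 1

lemma extMk_zero_eq_zero_iff {X Y : ModuleCat R} (P : ProjectiveResolution X)
    (f : P.complex.X 0 ⟶ Y) (hf : P.complex.d 1 0 ≫ f = 0) :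
    P.extMk f 1 rfl hf = 0 ↔ f = 0 := by
  refine ⟨fun h => ?_, fun h => by subst h; simp⟩
  simp only [← P.extEquivCohomologyClass.apply_eq_iff_eq,
    P.extEquivCohomologyClass_extMk, P.extEquivCohomologyClass_zero,
    CochainComplex.HomComplex.CohomologyClass.mk_eq_zero_iff] at h
  rw [CochainComplex.HomComplex.Cocycle.toSingleMk_mem_coboundaries_iff _ _ _ _ _ 1 (by lia)] at h
  obtain ⟨g, hg⟩ := h
  have hz : Limits.IsZero (P.cochainComplex.X 1) :=
    P.cochainComplex.isZero_of_isStrictlyLE 0 1 (by lia)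
  rw [hz.eq_of_src g 0, Limits.comp_zero] at hg
  rw [← cancel_epi (P.cochainComplexXIso (-0) 0 rfl).hom]
  simpa using hg.symm

/-- The class map from cocycles of a projective resolution to `Ext`. -/
noncomputable def cocycleToExt {X Y : ModuleCat.{0} R} (P : ProjectiveResolution X) (i n : ℕ) :
    LinearMap.ker ((P.complex.linearYonedaObj R Y).sc' i n (n + 1)).g.hom →ₗ[R]
      Abelian.Ext.{0} X Y n where
  toFun f := P.extMk f.1 (n + 1) rfl f.2
  map_add' _ _ := (P.add_extMk _ _ _ _ _ _).symm
  map_smul' r f := extMk_smul P r _ f.2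

lemma cocycleToExt_surjective {X Y : ModuleCat.{0} R} (P : ProjectiveResolution X) (i n : ℕ) :
    Function.Surjective (cocycleToExt (Y := Y) P i n) := fun α => by
  obtain ⟨f, hf, rfl⟩ := P.extMk_surjective α (n + 1) rfl
  exact ⟨⟨f, hf⟩, rfl⟩

lemma ker_cocycleToExt {X Y : ModuleCat.{0} R} (P : ProjectiveResolution X) (i n : ℕ)
    (hi : (ComplexShape.up ℕ).prev n = i) :
    LinearMap.ker (cocycleToExt (Y := Y) P i n) =
      LinearMap.range ((P.complex.linearYonedaObj R Y).sc' i n (n + 1)).moduleCatToCycles := by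
  ext ⟨f, hf⟩
  rw [LinearMap.mem_ker, LinearMap.mem_range]
  obtain _ | n := n
  · refine (extMk_zero_eq_zero_iff P f hf).trans ?_
    have h0 : P.complex.d 0 i = 0 := P.complex.shape _ _ (by simp)
    constructor
    · rintro rfl
      exact ⟨0, map_zero _⟩
    · rintro ⟨g, hg⟩
      have := congrArg Subtype.val hg
      exact this.symm.trans ((congrArg (· ≫ (show P.complex.X i ⟶ Y from g)) h0).trans
        Limits.zero_comp)
  · rw [CochainComplex.prev_nat_succ] at hi
    subst hi
    refine (P.extMk_eq_zero_iff f _ rfl hf n rfl).trans ?_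
    constructor
    · rintro ⟨g, hg⟩
      exact ⟨g, Subtype.ext hg⟩
    · rintro ⟨g, hg⟩
      exact ⟨g, congrArg Subtype.val hg⟩

/-- The two incarnations of `Ext` for modules agree. -/
noncomputable def extEquivMExt (M N : Type) [AddCommGroup M] [Module R M] [AddCommGroup N]
    [Module R N] (n : ℕ) : ext1 R n M N ≃ₗ[R] MExt R M N n :=
  let P := projectiveResolution (ModuleCat.of R M)
  let K := P.complex.linearYonedaObj R (ModuleCat.of R N)
  let i := (ComplexShape.up ℕ).prev n
  (P.isoExt n (ModuleCat.of R N) ≪≫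
    (ShortComplex.homologyMapIso (K.isoSc' i n (n + 1) rfl (by simp))) ≪≫
      (K.sc' i n (n + 1)).moduleCatHomologyIso).toLinearEquiv ≪≫ₗ
    (Submodule.quotEquivOfEq _ _ (ker_cocycleToExt P i n rfl).symm) ≪≫ₗ
    (LinearMap.quotKerEquivOfSurjective _ (cocycleToExt_surjective P i n))

end Bridge

section Devissage

open IsLocalRing
open scoped Pointwise

variable {R : Type} [CommRing R] {A B C N : Type} [AddCommGroup A] [Module R A]
  [AddCommGroup B] [Module R B] [AddCommGroup C] [Module R C] [AddCommGroup N] [Module R N]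

instance MExt.finite [IsNoetherianRing R] [Module.Finite R A] [Module.Finite R N] (i : ℕ) :
    Module.Finite R (MExt R A N i) :=
  ModuleCat.finite_ext R (ModuleCat.of R A) (ModuleCat.of R N) i

lemma MExt.pre_lsmul (x : R) (i : ℕ) (e : MExt R A N i) :
    MExt.pre (LinearMap.lsmul R A x) N i e = x • e := by
  have : LinearMap.lsmul R A x = x • LinearMap.id := by ext; simp
  rw [this, MExt.pre_smul, MExt.pre_id]

lemma MExt.post_lsmul (x : R) (i : ℕ) (e : MExt R N A i) :
    MExt.post (LinearMap.lsmul R A x) N i e = x • e := by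
  have : LinearMap.lsmul R A x = x • LinearMap.id := by ext; simp
  rw [this, MExt.post_smul, MExt.post_id]

lemma MExt.smul_eq_zero_of_left {x : R} (hx : ∀ a : A, x • a = 0) (i : ℕ) (e : MExt R A N i) :
    x • e = 0 := by
  rw [← MExt.pre_lsmul, show LinearMap.lsmul R A x = 0 by ext a; simpa using hx a]
  simp [MExt.pre]

lemma lsmul_mkQ_exact (x : R) (A : Type) [AddCommGroup A] [Module R A] :
    Function.Exact (LinearMap.lsmul R A x) (x • (⊤ : Submodule R A)).mkQ := by
  intro a
  simp [Submodule.mem_smul_pointwise_iff_exists]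

lemma MExt.smul_surjective_of_subsingleton_left {x : R} (hx : IsSMulRegular A x) {i : ℕ}
    (h : Subsingleton (MExt R (QuotSMulTop x A) N (i + 1))) (e : MExt R A N i) :
    ∃ e', x • e' = e := by
  obtain ⟨δ, h', -⟩ := MExt.exists_pre_delta (f := LinearMap.lsmul R A x) hx
    (Submodule.mkQ_surjective _)
    (lsmul_mkQ_exact x A) N i
  obtain ⟨y, rfl⟩ := (h' e).1 (Subsingleton.elim _ _)
  exact ⟨y, (MExt.pre_lsmul x i y).symm⟩

lemma subsingleton_of_smul_surjective [IsLocalRing R] [Module.Finite R A] {x : R}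
    (hx : x ∈ maximalIdeal R) (h : ∀ a : A, ∃ b, x • b = a) : Subsingleton A := by
  have hle : (⊤ : Submodule R A) ≤ maximalIdeal R • ⊤ := fun a _ => by
    obtain ⟨b, rfl⟩ := h a
    exact Submodule.smul_mem_smul hx trivial
  have := Submodule.eq_bot_of_le_smul_of_le_jacobson_bot _ _ Module.Finite.fg_top hle
    (maximalIdeal_le_jacobson _)
  exact (Submodule.subsingleton_iff R).1 (subsingleton_of_bot_eq_top this.symm)

/-- Nakayama for `Ext` in the first variable. -/
lemma MExt.subsingleton_of_quotSMulTop [IsNoetherianRing R] [IsLocalRing R] [Module.Finite R A]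
    [Module.Finite R N] {x : R} (hxm : x ∈ maximalIdeal R) (hx : IsSMulRegular A x) {i : ℕ}
    (h : Subsingleton (MExt R (QuotSMulTop x A) N (i + 1))) : Subsingleton (MExt R A N i) :=
  subsingleton_of_smul_surjective hxm (MExt.smul_surjective_of_subsingleton_left hx h)

/-- Prime filtration dévissage, keeping track of the primes that occur. -/
lemma devissage_of_annihilator [IsNoetherianRing R]
    {Q : (N : Type) → [AddCommGroup N] → [Module R N] → Prop}
    (hsub : ∀ (N : Type) [AddCommGroup N] [Module R N], Subsingleton N → Q N)
    (hequiv : ∀ (N N' : Type) [AddCommGroup N] [Module R N] [AddCommGroup N'] [Module R N'],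
      (N ≃ₗ[R] N') → Q N' → Q N)
    (hexact : ∀ (N₁ N₂ N₃ : Type) [AddCommGroup N₁] [Module R N₁] [AddCommGroup N₂] [Module R N₂]
      [AddCommGroup N₃] [Module R N₃] (f : N₁ →ₗ[R] N₂) (g : N₂ →ₗ[R] N₃),
      Function.Injective f → Function.Surjective g → Function.Exact f g → Q N₁ → Q N₃ → Q N₂)
    (N : Type) [AddCommGroup N] [Module R N] [Module.Finite R N]
    (h : ∀ q : Ideal R, q.IsPrime → Module.annihilator R N ≤ q → Q (R ⧸ q)) : Q N := by
  refine IsNoetherianRing.induction_on_isQuotientEquivQuotientPrime R (M := N) inferInstance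
    (motive := fun N _ _ _ => (∀ q : Ideal R, q.IsPrime → Module.annihilator R N ≤ q →
      Q (R ⧸ q)) → Q N) ?_ ?_ ?_ h
  · intro N _ _ _ h' _
    exact hsub N h'
  · intro N _ _ _ p e h'
    exact hequiv _ _ e (h' p.1 p.2 (by rw [e.annihilator_eq, Ideal.annihilator_quotient]))
  · intro N₁ _ _ _ N₂ _ _ _ N₃ _ _ _ f g hf hg hfg h₁ h₃ h'
    exact hexact _ _ _ f g hf hg hfg
      (h₁ fun q hq hle => h' q hq ((f.annihilator_le_of_injective hf).trans hle))
      (h₃ fun q hq hle => h' q hq ((g.annihilator_le_of_surjective hg).trans hle))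

lemma MExt.subsingleton_of_primes [IsNoetherianRing R] (Z : Type) [AddCommGroup Z] [Module R Z]
    (i : ℕ) (N : Type) [AddCommGroup N] [Module R N] [Module.Finite R N]
    (h : ∀ q : Ideal R, q.IsPrime → Module.annihilator R N ≤ q →
      Subsingleton (MExt R (R ⧸ q) Z i)) : Subsingleton (MExt R N Z i) := by
  refine devissage_of_annihilator (R := R) (Q := fun N _ _ => Subsingleton (MExt R N Z i))
    ?_ ?_ ?_ N h
  · intro N _ _ hN
    refine subsingleton_of_forall_eq 0 fun e => ?_
    rw [← one_smul R e]
    exact MExt.smul_eq_zero_of_left (fun a => Subsingleton.elim _ _) i e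
  · intro N N' _ _ _ _ e h'
    exact (MExt.preEquiv e Z i).symm.toEquiv.subsingleton
  · intro N₁ N₂ N₃ _ _ _ _ _ _ f g hf hg hfg h₁ h₃
    exact MExt.subsingleton_middle_left hf hg hfg h₁ h₃

lemma isSMulRegular_quotient_of_notMem {q : Ideal R} [q.IsPrime] {x : R} (hx : x ∉ q) :
    IsSMulRegular (R ⧸ q) x := by
  have : IsDomain (R ⧸ q) := Ideal.Quotient.isDomain q
  rw [isSMulRegular_iff_right_eq_zero_of_smul]
  intro a ha
  rw [Algebra.smul_def, mul_eq_zero] at ha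
  exact ha.resolve_left fun h => hx (Ideal.Quotient.eq_zero_iff_mem.1 h)

lemma sup_le_annihilator_quotSMulTop (q : Ideal R) (x : R) :
    q ⊔ Ideal.span {x} ≤ Module.annihilator R (QuotSMulTop x (R ⧸ q)) := by
  rw [sup_le_iff, Ideal.span_singleton_le_iff_mem]
  constructor
  · refine le_trans ?_ (LinearMap.annihilator_le_of_surjective _ (Submodule.mkQ_surjective _))
    rw [Ideal.annihilator_quotient]
  · rw [Module.mem_annihilator]
    intro a
    obtain ⟨a, rfl⟩ := Submodule.mkQ_surjective _ a
    exact (Submodule.Quotient.mk_eq_zero _).2 (Submodule.smul_mem_pointwise_smul a x ⊤ trivial)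

/-- To prove vanishing of `Ext^i(R/q, Z)`, it suffices to treat `Ext^{i+1}(R/q', Z)` for the
primes `q'` strictly above `q`. -/
lemma MExt.subsingleton_quotient_of_lt [IsNoetherianRing R] [IsLocalRing R] {Z : Type}
    [AddCommGroup Z] [Module R Z] [Module.Finite R Z] {i : ℕ} {q : Ideal R} [q.IsPrime]
    (hq : q ≠ maximalIdeal R)
    (h : ∀ q' : Ideal R, q'.IsPrime → q < q' → Subsingleton (MExt R (R ⧸ q') Z (i + 1))) :
    Subsingleton (MExt R (R ⧸ q) Z i) := by
  obtain ⟨x, hxm, hxq⟩ := SetLike.exists_of_lt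
    (lt_of_le_of_ne (le_maximalIdeal (Ideal.IsPrime.ne_top ‹_›)) hq)
  refine MExt.subsingleton_of_quotSMulTop hxm (isSMulRegular_quotient_of_notMem hxq)
    (MExt.subsingleton_of_primes Z _ _ fun q' hq' hle => h q' hq' ?_)
  have := (sup_le_annihilator_quotSMulTop q x).trans hle
  refine lt_of_le_of_ne (le_sup_left.trans this) fun heq => hxq ?_
  rw [heq]
  exact this (Ideal.mem_sup_right (Ideal.mem_span_singleton_self x))

end Devissage

section Depth

open IsLocalRing

variable {R : Type} [CommRing R] [IsLocalRing R]

/-- `Ext^i(k, N) = 0` for all `i < n`. -/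
def DepthGE (R : Type) [CommRing R] [IsLocalRing R] (n : ℕ) (N : Type) [AddCommGroup N]
    [Module R N] : Prop :=
  ∀ i < n, Subsingleton (MExt R (ResidueField R) N i)

lemma le_rdepth_iff (n : ℕ) (N : Type) [AddCommGroup N] [Module R N] :
    (n : ℕ∞) ≤ rdepth R N ↔ DepthGE R n N := by
  unfold rdepth DepthGE
  rw [le_sInf_iff]
  constructor
  · intro h i hi
    by_contra hne
    have := h i ⟨i, rfl, fun h' => hne (extEquivMExt _ _ i).symm.toEquiv.subsingleton⟩
    exact absurd (Nat.cast_le.1 this) (not_le.2 hi)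
  · rintro h _ ⟨i, rfl, hi⟩
    rw [Nat.cast_le]
    by_contra! hlt
    have := h i hlt
    exact hi (extEquivMExt _ _ i).toEquiv.subsingleton

variable {N : Type} [AddCommGroup N] [Module R N]

lemma DepthGE.mono {m n : ℕ} (h : DepthGE R n N) (hmn : m ≤ n) : DepthGE R m N :=
  fun i hi => h i (hi.trans_le hmn)

lemma DepthGE.congr {n : ℕ} {N' : Type} [AddCommGroup N'] [Module R N'] (e : N ≃ₗ[R] N')
    (h : DepthGE R n N) : DepthGE R n N' := fun i hi =>
  have := h i hi
  (MExt.postEquiv e (ResidueField R) i).symm.toEquiv.subsingleton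

lemma residueField_smul_eq_zero {x : R} (hx : x ∈ maximalIdeal R) (a : ResidueField R) :
    x • a = 0 := by
  rw [Algebra.smul_def]
  have : algebraMap R (ResidueField R) x = 0 := Ideal.Quotient.eq_zero_iff_mem.2 hx
  rw [this, zero_mul]

lemma DepthGE.exists_regular [IsNoetherianRing R] [Module.Finite R N] {n : ℕ}
    (h : DepthGE R (n + 1) N) : ∃ x ∈ maximalIdeal R, IsSMulRegular N x := by
  have := h 0 n.succ_pos
  have : Subsingleton (ResidueField R →ₗ[R] N) :=
    (MExt.zeroEquiv _ _).symm.toEquiv.subsingleton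
  obtain ⟨x, hx, hreg⟩ := IsSMulRegular.subsingleton_linearMap_iff.1 this
  refine ⟨x, ?_, hreg⟩
  have hann : Module.annihilator R (ResidueField R) = maximalIdeal R :=
    Ideal.annihilator_quotient
  rwa [hann] at hx

lemma DepthGE.quotSMulTop {n : ℕ} (h : DepthGE R (n + 1) N) {x : R} (hx : IsSMulRegular N x) :
    DepthGE R n (QuotSMulTop x N) := fun i hi =>
  MExt.subsingleton_of_left_right (f := LinearMap.lsmul R N x) hx
    (Submodule.mkQ_surjective _) (lsmul_mkQ_exact x N)
    (h (i + 1) (by lia)) (h i (by lia))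

omit [IsLocalRing R] in
lemma ringKrullDim_quotient_add_one_le {q q' : Ideal R} [q.IsPrime] (h : q < q') :
    ringKrullDim (R ⧸ q') + 1 ≤ ringKrullDim (R ⧸ q) := by
  obtain ⟨x, hx', hx⟩ := SetLike.exists_of_lt h
  refine ringKrullDim_succ_le_of_surjective (Ideal.Quotient.factor h.le)
    (Ideal.Quotient.factor_surjective h.le) (r := Ideal.Quotient.mk q x) ?_ ?_
  · exact mem_nonZeroDivisors_of_ne_zero fun h0 => hx (Ideal.Quotient.eq_zero_iff_mem.1 h0)
  · simpa using Ideal.Quotient.eq_zero_iff_mem.2 hx'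

/-- Ischebeck's vanishing theorem for cyclic modules given by primes. -/
lemma DepthGE.subsingleton_quotient [IsNoetherianRing R] [Module.Finite R N] {e : ℕ}
    (h : DepthGE R e N) (n : ℕ) (q : Ideal R) [hqp : q.IsPrime]
    (hq : ringKrullDim (R ⧸ q) ≤ n) (i : ℕ) (hi : i + n < e) :
    Subsingleton (MExt R (R ⧸ q) N i) := by
  induction n generalizing q i with
  | zero =>
    by_cases hqm : q = maximalIdeal R
    · subst hqm
      exact h i (by lia)
    · refine MExt.subsingleton_quotient_of_lt hqm fun q' hq' hlt => ?_
      have h1 := (ringKrullDim_quotient_add_one_le hlt).trans hq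
      have : Nontrivial (R ⧸ q') := Ideal.Quotient.nontrivial_iff.2 hq'.ne_top
      have h2 : (0 : WithBot ℕ∞) ≤ ringKrullDim (R ⧸ q') := ringKrullDim_nonneg_of_nontrivial
      have h3 : (1 : WithBot ℕ∞) ≤ 0 := by
        simpa using (add_le_add h2 (le_refl 1)).trans h1
      exact absurd h3 (by simp)
  | succ n ih =>
    by_cases hqm : q = maximalIdeal R
    · subst hqm
      exact h i (by lia)
    · refine MExt.subsingleton_quotient_of_lt hqm fun q' hq' hlt => ?_
      have h1 := (ringKrullDim_quotient_add_one_le hlt).trans hq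
      refine ih q' ?_ (i + 1) (by lia)
      rw [Nat.cast_succ] at h1
      exact ENat.WithBot.add_le_add_one_right_iff.1 h1

end Depth

section Vanishing

open IsLocalRing

variable {R : Type} [CommRing R] [IsNoetherianRing R] [IsLocalRing R]
  {N : Type} [AddCommGroup N] [Module R N] [Module.Finite R N]

/-- There are no nonzero maps from a module of small dimension to a module of large depth. -/
lemma DepthGE.subsingleton_linearMap {d : ℕ} (h : DepthGE R d N) (K : Type) [AddCommGroup K]
    [Module R K] [Module.Finite R K] (hK : mdim R K < d) : Subsingleton (K →ₗ[R] N) := by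
  have : Subsingleton (MExt R K N 0) := by
    refine MExt.subsingleton_of_primes N 0 K fun q hq hle => ?_
    have hlt : ringKrullDim (R ⧸ q) < d :=
      (ringKrullDim_le_of_surjective _ (Ideal.Quotient.factor_surjective hle)).trans_lt hK
    obtain _ | d := d
    · have : Nontrivial (R ⧸ q) := Ideal.Quotient.nontrivial_iff.2 hq.ne_top
      exact absurd hlt (not_lt.2 ringKrullDim_nonneg_of_nontrivial)
    · exact h.subsingleton_quotient d q (ENat.WithBot.lt_add_one_iff.1 hlt) 0 (by lia)
  exact (MExt.zeroEquiv K N).symm.toEquiv.subsingleton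

/-- A nonzero module has depth at most the dimension of the ring. -/
lemma DepthGE.subsingleton_of_ringKrullDim {d : ℕ} (hdim : ringKrullDim R = d)
    (h : DepthGE R (d + 1) N) : Subsingleton N := by
  have : Subsingleton (MExt R N N 0) :=
    MExt.subsingleton_of_primes N 0 N fun q hq _ =>
      h.subsingleton_quotient d q (hdim ▸ ringKrullDim_quotient_le q) 0 (by lia)
  have : Subsingleton (N →ₗ[R] N) := (MExt.zeroEquiv N N).symm.toEquiv.subsingleton
  exact subsingleton_of_forall_eq 0 fun a =>
    LinearMap.congr_fun (Subsingleton.elim LinearMap.id (0 : N →ₗ[R] N)) a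

omit [IsNoetherianRing R] [Module.Finite R N] in
lemma residueField_injective_of_ne_zero {f : ResidueField R →ₗ[R] N} (hf : f ≠ 0) :
    Function.Injective f := by
  have : IsSimpleModule R (ResidueField R) :=
    isSimpleModule_iff_quot_maximal.2 ⟨maximalIdeal R, inferInstance, ⟨LinearEquiv.refl _ _⟩⟩
  exact (LinearMap.injective_or_eq_zero f).resolve_right hf

omit [IsNoetherianRing R] [Module.Finite R N] in
lemma exists_residueField_injective (h : ¬ Subsingleton (MExt R (ResidueField R) N 0)) :
    ∃ f : ResidueField R →ₗ[R] N, Function.Injective f := by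
  have : ¬ Subsingleton (ResidueField R →ₗ[R] N) := fun h' =>
    h (MExt.zeroEquiv _ _).toEquiv.subsingleton
  rw [not_subsingleton_iff_nontrivial] at this
  obtain ⟨f, hf⟩ := exists_ne (0 : ResidueField R →ₗ[R] N)
  exact ⟨f, residueField_injective_of_ne_zero hf⟩

omit [IsNoetherianRing R] [Module.Finite R N] in
/-- The connecting map `Ext^n(k, N/xN) → Ext^{n+1}(k, N)` is surjective. -/
lemma exists_delta_quotSMulTop {x : R} (hxm : x ∈ maximalIdeal R) (hx : IsSMulRegular N x)
    (n : ℕ) : ∃ δ : MExt R (ResidueField R) (QuotSMulTop x N) n →ₗ[R]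
      MExt R (ResidueField R) N (n + 1), Function.Surjective δ ∧
      (Subsingleton (MExt R (ResidueField R) N n) → Function.Injective δ) := by
  obtain ⟨δ, h₁, h₂⟩ := MExt.exists_post_delta (f := LinearMap.lsmul R N x) hx
    (Submodule.mkQ_surjective _) (lsmul_mkQ_exact x N) (ResidueField R) n
  refine ⟨δ, fun e => (h₂ e).1 ?_, fun _ => ?_⟩
  · rw [MExt.post_lsmul]
    exact MExt.smul_eq_zero_of_left (residueField_smul_eq_zero hxm) _ _
  · rw [injective_iff_map_eq_zero]
    intro e he
    obtain ⟨y, rfl⟩ := (h₁ e).1 he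
    rw [Subsingleton.elim y 0, map_zero]

omit [IsNoetherianRing R] [Module.Finite R N] in
lemma MExt.subsingleton_succ_of_quotSMulTop {x : R} (hxm : x ∈ maximalIdeal R)
    (hx : IsSMulRegular N x) {n : ℕ}
    (h : Subsingleton (MExt R (ResidueField R) (QuotSMulTop x N) n)) :
    Subsingleton (MExt R (ResidueField R) N (n + 1)) := by
  obtain ⟨δ, hδ, -⟩ := exists_delta_quotSMulTop hxm hx n
  exact hδ.subsingleton

variable {ω : Type} [AddCommGroup ω] [Module R ω] [Module.Finite R ω]

lemma MExt.forall_subsingleton_of_residueField {t : ℕ}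
    (hV : ∀ (N : Type) [AddCommGroup N] [Module R N] [Module.Finite R N],
      Subsingleton (MExt R N ω (t + 1)))
    (hk : Subsingleton (MExt R (ResidueField R) ω t))
    (N : Type) [AddCommGroup N] [Module R N] [Module.Finite R N] :
    Subsingleton (MExt R N ω t) := by
  refine MExt.subsingleton_of_primes ω t N fun q hq _ => ?_
  by_cases hqm : q = maximalIdeal R
  · subst hqm
    exact hk
  · exact MExt.subsingleton_quotient_of_lt hqm fun q' _ _ => hV _

omit [Module.Finite R ω] in
lemma DepthGE.subsingleton_residueField {t : ℕ}
    (hV : ∀ (N : Type) [AddCommGroup N] [Module R N] [Module.Finite R N],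
      Subsingleton (MExt R N ω (t + 1))) (n : ℕ)
    (N : Type) [AddCommGroup N] [Module R N] [Module.Finite R N] (hN : DepthGE R n N)
    (hn : ¬ Subsingleton (MExt R (ResidueField R) N n)) (e : ℕ)
    (he : ∀ i > e, Subsingleton (MExt R N ω i)) (ht : e + n < t) :
    Subsingleton (MExt R (ResidueField R) ω t) := by
  induction n generalizing N e with
  | zero =>
    obtain ⟨f, hf⟩ := exists_residueField_injective hn
    exact MExt.subsingleton_of_right_left hf (Submodule.mkQ_surjective _)
      (LinearMap.exact_map_mkQ_range f) (he t (by lia)) (hV _)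
  | succ n ih =>
    obtain ⟨x, hxm, hx⟩ := hN.exists_regular
    refine ih (QuotSMulTop x N) (hN.quotSMulTop hx)
      (fun h => hn (MExt.subsingleton_succ_of_quotSMulTop hxm hx h)) (e + 1) (fun i hi => ?_)
      (by lia)
    obtain ⟨i, rfl⟩ := Nat.exists_eq_add_of_lt hi
    exact MExt.subsingleton_of_left_left (f := LinearMap.lsmul R N x) hx
      (Submodule.mkQ_surjective _) (lsmul_mkQ_exact x N) (he _ (by lia)) (he _ (by lia))

/-- The injective dimension of a canonical module is at most the dimension of the ring. -/
lemma MExt.subsingleton_of_gt {d : ℕ} (hdim : ringKrullDim R = d) (hR : DepthGE R d R)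
    (hω : HasFID R ω) (i : ℕ) (hi : d < i) (N : Type) [AddCommGroup N] [Module R N]
    [Module.Finite R N] : Subsingleton (MExt R N ω i) := by
  obtain ⟨n₀, hn₀⟩ := hω
  suffices H : ∀ j i : ℕ, d < i → n₀ < i + j → ∀ (N : Type) [AddCommGroup N] [Module R N]
      [Module.Finite R N], Subsingleton (MExt R N ω i) from H (n₀ + 1) i hi (by lia) N
  intro j
  induction j with
  | zero => exact fun i _ hi' N _ _ _ =>
      have := hn₀ N i hi'
      (extEquivMExt _ _ i).symm.toEquiv.subsingleton
  | succ j ih =>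
    intro i hi hi' N _ _ _
    have hV : ∀ (N : Type) [AddCommGroup N] [Module R N] [Module.Finite R N],
      Subsingleton (MExt R N ω (i + 1)) := ih (i + 1) (by lia) (by lia)
    refine MExt.forall_subsingleton_of_residueField hV ?_ N
    refine DepthGE.subsingleton_residueField hV d R hR (fun h => ?_) 0 (fun i hi => ?_) (by lia)
    · have hR' : DepthGE R (d + 1) R := fun i hi => by
        obtain rfl | hlt := (Nat.lt_succ_iff.1 hi).eq_or_lt
        exacts [h, hR i hlt]
      exact not_subsingleton R (hR'.subsingleton_of_ringKrullDim hdim)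
    · obtain ⟨i, rfl⟩ := Nat.exists_eq_add_of_lt hi
      exact MExt.subsingleton_of_projective _

end Vanishing

section Canonical

open IsLocalRing

variable {R : Type} [CommRing R] [IsNoetherianRing R] [IsLocalRing R]

/-- The properties of a canonical module over a Cohen-Macaulay local ring, expressed through
the derived-category `Ext`. -/
structure CanonicalSetup (R : Type) [CommRing R] [IsLocalRing R] (d : ℕ) (ω : Type)
    [AddCommGroup ω] [Module R ω] : Prop where
  ringKrullDim_eq : ringKrullDim R = d
  depthGE_ring : DepthGE R d R
  finite : Module.Finite R ω
  depthGE : DepthGE R d ω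
  subsingleton_ext : ∀ i > d, ∀ (N : Type) [AddCommGroup N] [Module R N] [Module.Finite R N],
    Subsingleton (MExt R N ω i)
  nonempty_equiv : Nonempty (MExt R (ResidueField R) ω d ≃ₗ[R] ResidueField R)

lemma IsCanonicalModule.canonicalSetup {d : ℕ} {ω : Type} [AddCommGroup ω] [Module R ω]
    (hω : IsCanonicalModule R d ω) (hdim : ringKrullDim R = d) (hCM : (d : ℕ∞) ≤ rdepth R R) :
    CanonicalSetup R d ω :=
  have := hω.1.1
  have hR := (le_rdepth_iff d R).1 hCM
  { ringKrullDim_eq := hdim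
    depthGE_ring := hR
    finite := hω.1.1
    depthGE := (le_rdepth_iff d ω).1 hω.1.2
    subsingleton_ext := fun i hi N _ _ _ => MExt.subsingleton_of_gt hdim hR hω.2.1 i hi N
    nonempty_equiv := hω.2.2.map ((extEquivMExt _ _ d).symm.trans ·) }

variable {d : ℕ} {ω : Type} [AddCommGroup ω] [Module R ω] (S : CanonicalSetup R d ω)
include S

omit [IsNoetherianRing R] in
lemma CanonicalSetup.not_subsingleton : ¬ Subsingleton (MExt R (ResidueField R) ω d) := fun _ =>
  _root_.not_subsingleton (ResidueField R) (S.nonempty_equiv.some.symm.toEquiv.subsingleton)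

lemma CanonicalSetup.subsingleton_of_depthGE (n : ℕ) (N : Type) [AddCommGroup N] [Module R N]
    [Module.Finite R N] (hN : DepthGE R n N) (i : ℕ) (hi : d < i + n) :
    Subsingleton (MExt R N ω i) := by
  have := S.finite
  induction n generalizing N i with
  | zero => exact S.subsingleton_ext i hi N
  | succ n ih =>
    obtain ⟨x, hxm, hx⟩ := hN.exists_regular
    exact MExt.subsingleton_of_quotSMulTop hxm hx
      (ih _ (hN.quotSMulTop hx) (i + 1) (by lia))

lemma CanonicalSetup.subsingleton_residueField (n : ℕ) (N : Type) [AddCommGroup N] [Module R N]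
    [Module.Finite R N] (hN : DepthGE R n N) (j : ℕ) (hj : j + n = d)
    (h : Subsingleton (MExt R N ω j)) : Subsingleton (MExt R (ResidueField R) N n) := by
  induction n generalizing N j with
  | zero =>
    obtain rfl : j = d := hj
    by_contra hne
    obtain ⟨f, hf⟩ := exists_residueField_injective hne
    exact S.not_subsingleton (MExt.subsingleton_of_right_left hf (Submodule.mkQ_surjective _)
      (LinearMap.exact_map_mkQ_range f) h (S.subsingleton_ext _ (by lia) _))
  | succ n ih =>
    obtain ⟨x, hxm, hx⟩ := hN.exists_regular
    refine MExt.subsingleton_succ_of_quotSMulTop hxm hx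
      (ih _ (hN.quotSMulTop hx) (j + 1) (by lia) ?_)
    exact MExt.subsingleton_of_left_left (f := LinearMap.lsmul R N x) hx
      (Submodule.mkQ_surjective _) (lsmul_mkQ_exact x N) h
      (S.subsingleton_of_depthGE (n + 1) N hN _ (by lia))

/-- The dual of a nonzero maximal Cohen-Macaulay module is nonzero. -/
lemma CanonicalSetup.subsingleton_of_dual (N : Type) [AddCommGroup N] [Module R N]
    [Module.Finite R N] (hN : DepthGE R d N) (h : Subsingleton (N →ₗ[R] ω)) :
    Subsingleton N := by
  have h0 : Subsingleton (MExt R N ω 0) := (MExt.zeroEquiv N ω).toEquiv.subsingleton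
  have hd := S.subsingleton_residueField d N hN 0 (zero_add d) h0
  refine DepthGE.subsingleton_of_ringKrullDim S.ringKrullDim_eq fun i hi => ?_
  obtain rfl | hlt := (Nat.lt_succ_iff.1 hi).eq_or_lt
  exacts [hd, hN i hlt]

omit [IsNoetherianRing R] S

/-- Nakayama: a module with a map to the residue field with small kernel is cyclic. -/
lemma exists_span_singleton_eq_top {E : Type} [AddCommGroup E] [Module R E] [Module.Finite R E]
    {e : E} (h : ∀ a : E, ∃ r : R, a - r • e ∈ maximalIdeal R • (⊤ : Submodule R E)) :
    Submodule.span R {e} = ⊤ := by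
  rw [eq_top_iff]
  refine Submodule.le_of_le_smul_of_le_jacobson_bot Module.Finite.fg_top
    (maximalIdeal_le_jacobson _) fun a _ => ?_
  obtain ⟨r, hr⟩ := h a
  rw [← add_sub_cancel (r • e) a]
  exact Submodule.add_mem_sup
    (Submodule.smul_mem _ _ (Submodule.mem_span_singleton_self e)) hr

omit [IsLocalRing R] in
lemma MExt.pre_sum {A B N ι : Type} [AddCommGroup A] [Module R A] [AddCommGroup B] [Module R B]
    [AddCommGroup N] [Module R N] (s : Finset ι) (f : ι → (A →ₗ[R] B)) (i : ℕ)
    (e : MExt R B N i) : MExt.pre (∑ a ∈ s, f a) N i e = ∑ a ∈ s, MExt.pre (f a) N i e := by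
  classical
  induction s using Finset.induction_on with
  | empty => simp [MExt.pre]
  | insert a s ha ih => rw [Finset.sum_insert ha, Finset.sum_insert ha, MExt.pre_add, ih]

lemma exists_residueField_exact [IsNoetherianRing R] (N : Type) [AddCommGroup N] [Module R N]
    (h : Nonempty ((ResidueField R →ₗ[R] N) ≃ₗ[R] ResidueField R)) :
    ∃ (f : ResidueField R →ₗ[R] N) (s : Finset R), Function.Injective f ∧
      (∀ x ∈ s, x ∈ maximalIdeal R) ∧
      ∀ b : N, (∀ x ∈ s, x • b = 0) ↔ b ∈ LinearMap.range f := by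
  obtain ⟨e⟩ := h
  obtain ⟨s, hs⟩ := (inferInstance : IsNoetherianRing R).noetherian (maximalIdeal R)
  have hsm : ∀ x ∈ s, x ∈ maximalIdeal R := fun x hx => hs ▸ Submodule.subset_span hx
  refine ⟨e.symm 1, s, ?_, hsm, fun b => ⟨fun hb => ?_, ?_⟩⟩
  · exact residueField_injective_of_ne_zero (by simp)
  · let g : ResidueField R →ₗ[R] N := Submodule.liftQ _ (LinearMap.toSpanSingleton R N b) (by
      rw [← hs, Submodule.span_le]
      intro x hx
      simpa using hb x hx)
    obtain ⟨r, hr⟩ := IsLocalRing.residue_surjective (e g)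
    refine ⟨residue R r, ?_⟩
    have h1 : residue R r = r • (1 : ResidueField R) := by
      rw [Algebra.smul_def, mul_one]; rfl
    have h2 : g = r • e.symm 1 := by
      rw [← map_smul, ← h1, hr, e.symm_apply_apply]
    rw [h1, map_smul, ← LinearMap.smul_apply, ← h2]
    change LinearMap.toSpanSingleton R N b 1 = b
    simp
  · rintro ⟨c, rfl⟩ x hx
    rw [← map_smul, residueField_smul_eq_zero (hsm x hx), map_zero]

include S in
lemma CanonicalSetup.exists_span_singleton_eq_top [IsNoetherianRing R] (n : ℕ) (N : Type)
    [AddCommGroup N] [Module R N]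
    [Module.Finite R N] (hN : DepthGE R n N) (j : ℕ) (hj : j + n = d)
    (h : Nonempty (MExt R (ResidueField R) N n ≃ₗ[R] ResidueField R)) :
    ∃ g : MExt R N ω j, Submodule.span R {g} = ⊤ := by
  classical
  have := S.finite
  induction n generalizing N j with
  | zero =>
    obtain rfl : j = d := hj
    obtain ⟨f, s, hf, hsm, hs⟩ := exists_residueField_exact N
      (h.map ((MExt.zeroEquiv _ _).symm.trans ·))
    let φ : N →ₗ[R] (s → N) := ∑ x : s, (x : R) • LinearMap.single R (fun _ : s => N) x
    have hφ : ∀ b x, φ b x = (x : R) • b := by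
      intro b x
      simp [φ, LinearMap.sum_apply, Finset.sum_apply, Pi.single_apply]
    have hex : Function.Exact f φ.rangeRestrict := by
      intro b
      rw [← LinearMap.coe_range, SetLike.mem_coe, ← hs, Subtype.ext_iff]
      constructor
      · intro hb x hx
        rw [← hφ b ⟨x, hx⟩]
        exact congrFun hb _
      · intro hb
        funext x
        exact (hφ b x).trans (hb x x.2)
    have hker : ∀ a, MExt.pre f ω j a = 0 → a ∈ maximalIdeal R • (⊤ : Submodule R
        (MExt R N ω j)) := by
      intro a ha
      obtain ⟨u, rfl⟩ := (MExt.pre_exact hf φ.surjective_rangeRestrict hex ω j a).1 ha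
      obtain ⟨δ, hδ, -⟩ := MExt.exists_pre_delta (Submodule.injective_subtype (LinearMap.range φ))
        (Submodule.mkQ_surjective _) (LinearMap.exact_subtype_mkQ _) ω j
      have := S.subsingleton_ext (j + 1) (by lia) ((s → N) ⧸ LinearMap.range φ)
      obtain ⟨z, rfl⟩ := (hδ u).1 (Subsingleton.elim _ _)
      rw [← MExt.pre_comp]
      change MExt.pre φ ω j z ∈ _
      rw [MExt.pre_sum]
      refine Submodule.sum_mem _ fun x _ => ?_
      rw [MExt.pre_smul]
      exact Submodule.smul_mem_smul (hsm x x.2) trivial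
    obtain ⟨ε⟩ := S.nonempty_equiv
    by_cases hp : ∀ a, MExt.pre f ω j a = 0
    · exact ⟨0, _root_.exists_span_singleton_eq_top fun a => ⟨0, by simpa using hker a (hp a)⟩⟩
    · push Not at hp
      obtain ⟨g, hg⟩ := hp
      refine ⟨g, _root_.exists_span_singleton_eq_top fun a => ?_⟩
      obtain ⟨r, hr⟩ := IsLocalRing.residue_surjective
        (ε (MExt.pre f ω j a) / ε (MExt.pre f ω j g))
      refine ⟨r, hker _ (ε.injective ?_)⟩
      rw [map_zero, map_sub, map_smul, map_sub, map_smul, sub_eq_zero, Algebra.smul_def]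
      change _ = residue R r * _
      rw [hr, div_mul_cancel₀]
      simpa using hg
  | succ n ih =>
    obtain ⟨x, hxm, hx⟩ := hN.exists_regular
    obtain ⟨δ, hδ, hδ'⟩ := exists_delta_quotSMulTop hxm hx n
    let ε := LinearEquiv.ofBijective δ ⟨hδ' (hN n (by lia)), hδ⟩
    obtain ⟨g', hg'⟩ := ih (QuotSMulTop x N) (hN.quotSMulTop hx) (j + 1) (by lia)
      (h.map (ε.trans ·))
    obtain ⟨δ', h₁, h₂⟩ := MExt.exists_pre_delta (f := LinearMap.lsmul R N x) hx
      (Submodule.mkQ_surjective _) (lsmul_mkQ_exact x N) ω j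
    have := S.subsingleton_of_depthGE (n + 1) N hN (j + 1) (by lia)
    obtain ⟨g, rfl⟩ := (h₂ g').1 (Subsingleton.elim _ _)
    refine ⟨g, _root_.exists_span_singleton_eq_top fun a => ?_⟩
    obtain ⟨r, hr⟩ := Submodule.mem_span_singleton.1 (hg' ▸ Submodule.mem_top : δ' a ∈ _)
    obtain ⟨b, hb⟩ := (h₁ (a - r • g)).1 (by rw [map_sub, map_smul, hr, sub_self])
    refine ⟨r, ?_⟩
    rw [← hb, MExt.pre_lsmul]
    exact Submodule.smul_mem_smul hxm trivial

end Canonical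

section HomExact

variable {R : Type} [CommRing R] {A B C N : Type} [AddCommGroup A] [Module R A]
  [AddCommGroup B] [Module R B] [AddCommGroup C] [Module R C] [AddCommGroup N] [Module R N]
  {f : A →ₗ[R] B} {g : B →ₗ[R] C}

lemma exists_extension_of_subsingleton (hf : Function.Injective f) (hg : Function.Surjective g)
    (h : Function.Exact f g) (hC : Subsingleton (MExt R C N 1)) (φ : A →ₗ[R] N) :
    ∃ ψ : B →ₗ[R] N, ψ ∘ₗ f = φ := by
  obtain ⟨δ, hδ, -⟩ := MExt.exists_pre_delta hf hg h N 0
  obtain ⟨y, hy⟩ := (hδ ((MExt.zeroEquiv A N).symm φ)).1 (Subsingleton.elim _ _)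
  obtain ⟨ψ, rfl⟩ := (MExt.zeroEquiv B N).symm.surjective y
  rw [MExt.pre_zeroEquiv_symm] at hy
  exact ⟨ψ, (MExt.zeroEquiv A N).symm.injective hy⟩

lemma exists_lift_of_subsingleton (hf : Function.Injective f) (hg : Function.Surjective g)
    (h : Function.Exact f g) (hA : Subsingleton (MExt R N A 1)) (φ : N →ₗ[R] C) :
    ∃ ψ : N →ₗ[R] B, g ∘ₗ ψ = φ := by
  obtain ⟨δ, hδ, -⟩ := MExt.exists_post_delta hf hg h N 0
  obtain ⟨y, hy⟩ := (hδ ((MExt.zeroEquiv N C).symm φ)).1 (Subsingleton.elim _ _)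
  obtain ⟨ψ, rfl⟩ := (MExt.zeroEquiv N B).symm.surjective y
  rw [MExt.post_zeroEquiv_symm] at hy
  exact ⟨ψ, (MExt.zeroEquiv N C).symm.injective hy⟩

lemma dmap_injective (hg : Function.Surjective g) : Function.Injective (dmap R N g) :=
  LinearMap.lcomp_injective_of_surjective g hg

lemma dmap_exact (hg : Function.Surjective g) (h : Function.Exact f g) :
    Function.Exact (dmap R N g) (dmap R N f) :=
  LinearMap.exact_lcomp_of_exact_of_surjective N h hg

lemma dmap_surjective (hf : Function.Injective f) (hg : Function.Surjective g)
    (h : Function.Exact f g) (hC : Subsingleton (MExt R C N 1)) :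
    Function.Surjective (dmap R N f) :=
  exists_extension_of_subsingleton hf hg h hC

lemma MExt.post_sum {ι : Type} (s : Finset ι) (f : ι → (A →ₗ[R] B)) (i : ℕ)
    (e : MExt R N A i) : MExt.post (∑ a ∈ s, f a) N i e = ∑ a ∈ s, MExt.post (f a) N i e := by
  classical
  induction s using Finset.induction_on with
  | empty => simp [MExt.post]
  | insert a s ha ih => rw [Finset.sum_insert ha, Finset.sum_insert ha, MExt.post_add, ih]

end HomExact

section Duality

open IsLocalRing

variable {R : Type} [CommRing R] [IsLocalRing R]

lemma DepthGE.pi {n : ℕ} {N : Type} [AddCommGroup N] [Module R N] (h : DepthGE R n N) (m : ℕ) :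
    DepthGE R n (Fin m → N) := by
  intro i hi
  refine subsingleton_of_forall_eq 0 fun e => ?_
  have hid : (LinearMap.id : (Fin m → N) →ₗ[R] (Fin m → N)) =
      ∑ a, LinearMap.single R (fun _ => N) a ∘ₗ LinearMap.proj a := by
    ext a v b
    simp [Pi.single_apply]
  have := h i hi
  rw [← MExt.post_id i e, hid, MExt.post_sum]
  refine Finset.sum_eq_zero fun a _ => ?_
  rw [MExt.post_comp, Subsingleton.elim (MExt.post _ _ _ e) 0, map_zero]

lemma DepthGE.of_exact {n : ℕ} {A B C : Type} [AddCommGroup A] [Module R A]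
    [AddCommGroup B] [Module R B] [AddCommGroup C] [Module R C] {f : A →ₗ[R] B} {g : B →ₗ[R] C}
    (hf : Function.Injective f) (hg : Function.Surjective g) (h : Function.Exact f g)
    (hB : DepthGE R (n + 1) B) (hC : DepthGE R n C) : DepthGE R (n + 1) A := by
  rintro (_ | i) hi
  · have := hB 0 hi
    exact (MExt.post_zero_injective hf (ResidueField R)).subsingleton
  · exact MExt.subsingleton_of_right_right hf hg h (hB _ hi) (hC i (by lia))

lemma DepthGE.of_exact_of_le {n : ℕ} {A B C : Type} [AddCommGroup A] [Module R A]
    [AddCommGroup B] [Module R B] [AddCommGroup C] [Module R C] {f : A →ₗ[R] B} {g : B →ₗ[R] C}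
    (hf : Function.Injective f) (hg : Function.Surjective g) (h : Function.Exact f g)
    (hB : DepthGE R n B) (hC : DepthGE R n C) : DepthGE R n A := by
  obtain _ | n := n
  · exact fun i hi => absurd hi (by lia)
  · exact DepthGE.of_exact hf hg h hB (hC.mono n.le_succ)

lemma DepthGE.exists_cover {n : ℕ} (hR : DepthGE R n R) (X : Type) [AddCommGroup X] [Module R X]
    [Module.Finite R X] (hX : DepthGE R n X) : ∃ (m : ℕ) (g : (Fin m → R) →ₗ[R] X),
      Function.Surjective g ∧ DepthGE R n (LinearMap.ker g) := by
  obtain ⟨m, g, hg⟩ := Module.Finite.exists_fin' R X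
  exact ⟨m, g, hg, DepthGE.of_exact_of_le (Submodule.injective_subtype _) hg
    (LinearMap.exact_subtype_ker_map g) (hR.pi m) hX⟩

variable [IsNoetherianRing R] {d : ℕ} {ω : Type} [AddCommGroup ω] [Module R ω]
  (S : CanonicalSetup R d ω) (X : Type) [AddCommGroup X] [Module R X] [Module.Finite R X]

include S

lemma CanonicalSetup.subsingleton_ext_one (hX : DepthGE R d X) : Subsingleton (MExt R X ω 1) :=
  S.subsingleton_of_depthGE d X hX 1 (by lia)

/-- The dual of a maximal Cohen-Macaulay module is maximal Cohen-Macaulay. -/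
lemma CanonicalSetup.depthGE_dual (hX : DepthGE R d X) : DepthGE R d (X →ₗ[R] ω) := by
  suffices H : ∀ j ≤ d, ∀ (X : Type) [AddCommGroup X] [Module R X] [Module.Finite R X],
      DepthGE R d X → DepthGE R j (X →ₗ[R] ω) from H d le_rfl X hX
  intro j
  induction j with
  | zero => exact fun _ _ _ _ _ _ i hi => absurd hi (by lia)
  | succ j ih =>
    intro hj X _ _ _ hX
    obtain ⟨m, g, hg, hK⟩ := S.depthGE_ring.exists_cover X hX
    have hex := LinearMap.exact_subtype_ker_map g
    refine DepthGE.of_exact (dmap_injective hg)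
      (dmap_surjective (Submodule.injective_subtype _) hg hex
        (S.subsingleton_ext_one X hX)) (dmap_exact hg hex) ?_ (ih (by lia) _ hK)
    exact ((S.depthGE.pi m).congr ((Pi.basisFun R (Fin m)).constr R)).mono hj

lemma CanonicalSetup.exists_eq_smul (φ : ω →ₗ[R] ω) : ∃ r : R, ∀ w, φ w = r • w := by
  have := S.finite
  obtain ⟨g, hg⟩ := S.exists_span_singleton_eq_top d ω S.depthGE 0 (by lia) S.nonempty_equiv
  set e := MExt.zeroEquiv ω ω g
  have key : ∀ ψ : ω →ₗ[R] ω, ∃ r : R, r • e = ψ := fun ψ => by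
    obtain ⟨r, hr⟩ := Submodule.mem_span_singleton.1
      (hg ▸ Submodule.mem_top : (MExt.zeroEquiv ω ω).symm ψ ∈ _)
    exact ⟨r, by rw [← map_smul, hr, LinearEquiv.apply_symm_apply]⟩
  obtain ⟨r, hr⟩ := key LinearMap.id
  obtain ⟨s, hs⟩ := key (e ∘ₗ e)
  obtain ⟨t, rfl⟩ := key φ
  have h1 : (1 - r * s) • e = 0 := by
    rw [sub_smul, one_smul, mul_smul, hs, ← LinearMap.comp_smul, hr, LinearMap.comp_id, sub_self]
  rcases IsLocalRing.isUnit_or_isUnit_one_sub_self (r * s) with hu | hu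
  · obtain ⟨u, hu⟩ := isUnit_of_mul_isUnit_left hu
    refine ⟨t * (u⁻¹ : Rˣ), fun w => ?_⟩
    rw [mul_smul, LinearMap.smul_apply]
    congr 1
    have := LinearMap.congr_fun hr w
    rw [← hu, LinearMap.smul_apply, LinearMap.id_apply] at this
    nth_rw 2 [← this]
    rw [← mul_smul, Units.inv_mul, one_smul]
  · have h0 : e = 0 := (hu.smul_eq_zero).1 h1
    exact ⟨0, fun w => by simp [h0]⟩

/-- A canonical module is faithful. -/
lemma CanonicalSetup.eq_zero_of_smul_eq_zero {r : R} (h : ∀ w : ω, r • w = 0) : r = 0 := by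
  have := S.finite
  let J := LinearMap.ker (LinearMap.lsmul R ω)
  have hsurj : Function.Surjective (LinearMap.lsmul R ω) := fun φ => by
    obtain ⟨r, hr⟩ := S.exists_eq_smul φ
    exact ⟨r, LinearMap.ext fun w => (hr w).symm⟩
  have hex := LinearMap.exact_subtype_ker_map (LinearMap.lsmul R ω)
  have hE : DepthGE R d (ω →ₗ[R] ω) := S.depthGE_dual ω S.depthGE
  have hJ : DepthGE R d J :=
    DepthGE.of_exact_of_le (Submodule.injective_subtype _) hsurj hex S.depthGE_ring hE
  have : Subsingleton (J →ₗ[R] ω) := by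
    refine subsingleton_of_forall_eq 0 fun φ => ?_
    obtain ⟨ψ, rfl⟩ := exists_extension_of_subsingleton (Submodule.injective_subtype _) hsurj hex
      (S.subsingleton_ext_one _ hE) φ
    ext a
    have ha := LinearMap.congr_fun a.2 (ψ 1)
    change (a : R) • ψ 1 = 0 at ha
    rw [← map_smul, smul_eq_mul, mul_one] at ha
    exact ha
  have hJ0 := S.subsingleton_of_dual J hJ this
  exact congrArg Subtype.val (Subsingleton.elim (⟨r, LinearMap.ext h⟩ : J) 0)

lemma CanonicalSetup.deltaMap_pi_surjective (m : ℕ) :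
    Function.Surjective (deltaMap R ω (Fin m → R)) := by
  intro θ
  let b := Pi.basisFun R (Fin m)
  choose r hr using fun i => S.exists_eq_smul
    (θ ∘ₗ (b.constr R).toLinearMap ∘ₗ LinearMap.single R (fun _ => ω) i)
  refine ⟨r, LinearMap.ext fun φ => ?_⟩
  obtain ⟨w, rfl⟩ := (b.constr R).surjective φ
  have hw : w = ∑ i, Pi.single i (w i) := (Finset.univ_sum_single w).symm
  change b.constr R w r = _
  conv_rhs => rw [hw]
  rw [map_sum, map_sum, Module.Basis.constr_apply_fintype]
  refine Finset.sum_congr rfl fun i _ => ?_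
  simpa [b] using (hr i (w i)).symm

lemma CanonicalSetup.eq_zero_of_forall_dual {m : ℕ} {v : Fin m → R}
    (h : ∀ φ : (Fin m → R) →ₗ[R] ω, φ v = 0) : v = 0 :=
  funext fun i => S.eq_zero_of_smul_eq_zero fun w =>
    h (LinearMap.toSpanSingleton R ω w ∘ₗ LinearMap.proj i)

lemma CanonicalSetup.deltaMap_surjective (hX : DepthGE R d X) :
    Function.Surjective (deltaMap R ω X) := by
  intro θ
  obtain ⟨m, g, hg, hK⟩ := S.depthGE_ring.exists_cover X hX
  have hex := LinearMap.exact_subtype_ker_map g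
  have := S.finite
  obtain ⟨θ', rfl⟩ := exists_extension_of_subsingleton (dmap_injective hg)
    (dmap_surjective (Submodule.injective_subtype _) hg hex
      (S.subsingleton_ext_one X hX)) (dmap_exact hg hex)
    (S.subsingleton_ext_one _ (S.depthGE_dual _ hK)) θ
  obtain ⟨v, rfl⟩ := S.deltaMap_pi_surjective m θ'
  exact ⟨g v, rfl⟩

/-- Maximal Cohen-Macaulay modules are reflexive with respect to the canonical module. -/
lemma CanonicalSetup.deltaMap_bijective (hX : DepthGE R d X) :
    Function.Bijective (deltaMap R ω X) := by
  refine ⟨?_, S.deltaMap_surjective X hX⟩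
  rw [injective_iff_map_eq_zero]
  intro x hx
  obtain ⟨m, g, hg, hK⟩ := S.depthGE_ring.exists_cover X hX
  obtain ⟨v, rfl⟩ := hg x
  have hex := LinearMap.exact_subtype_ker_map g
  have hsurj : Function.Surjective (dmap R ω (LinearMap.ker g).subtype) :=
    dmap_surjective (Submodule.injective_subtype _) hg hex
      (S.subsingleton_ext_one X hX)
  obtain ⟨θ, hθ⟩ := (dmap_exact hsurj (dmap_exact hg hex)
    (deltaMap R ω (Fin m → R) v)).1 (LinearMap.ext fun φ => LinearMap.congr_fun hx φ)
  obtain ⟨x', rfl⟩ := S.deltaMap_surjective _ hK θ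
  have : v - x' = 0 := S.eq_zero_of_forall_dual fun φ => by
    rw [map_sub, sub_eq_zero]
    exact (LinearMap.congr_fun hθ φ).symm
  rw [sub_eq_zero.1 this]
  exact x'.2

end Duality

section Torsion

open Module

variable {R : Type} [CommRing R] (p : Ideal R) [p.IsPrime]

lemma isTorsion'_of_exact {A B C : Type} [AddCommGroup A] [Module R A]
    [AddCommGroup B] [Module R B] [AddCommGroup C] [Module R C] {f : A →ₗ[R] B} {g : B →ₗ[R] C}
    (h : Function.Exact f g) (hA : IsTorsion' A p.primeCompl) (hC : IsTorsion' C p.primeCompl) :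
    IsTorsion' B p.primeCompl := by
  intro b
  obtain ⟨s, hs⟩ := @hC (g b)
  obtain ⟨a, ha⟩ := (h (s • b)).1 (by rw [Submonoid.smul_def, map_smul, ← Submonoid.smul_def, hs])
  obtain ⟨t, ht⟩ := @hA a
  exact ⟨t * s, by rw [mul_smul, ← ha, Submonoid.smul_def, ← map_smul, ← Submonoid.smul_def, ht,
    map_zero]⟩

lemma isTorsion'_of_injective {A B : Type} [AddCommGroup A] [Module R A]
    [AddCommGroup B] [Module R B] {f : A →ₗ[R] B} (hf : Function.Injective f)
    (hB : IsTorsion' B p.primeCompl) : IsTorsion' A p.primeCompl := by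
  intro a
  obtain ⟨s, hs⟩ := @hB (f a)
  exact ⟨s, hf (by rw [Submonoid.smul_def, map_smul, ← Submonoid.smul_def, hs, map_zero])⟩

lemma isTorsion'_of_subsingleton {A : Type} [AddCommGroup A] [Module R A] (h : Subsingleton A) :
    IsTorsion' A p.primeCompl :=
  fun _ => ⟨1, Subsingleton.elim _ _⟩

/-- Torsion of `Ext` at a minimal prime can be checked on the quotient by that prime. -/
lemma MExt.isTorsion'_of_quotient [IsNoetherianRing R] (hp : p ∈ minimalPrimes R) (Z : Type)
    [AddCommGroup Z] [Module R Z] (i : ℕ)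
    (h : IsTorsion' (MExt R (R ⧸ p) Z i) p.primeCompl) (N : Type) [AddCommGroup N] [Module R N]
    [Module.Finite R N] : IsTorsion' (MExt R N Z i) p.primeCompl := by
  refine devissage_of_annihilator (R := R)
    (Q := fun N _ _ => IsTorsion' (MExt R N Z i) p.primeCompl) ?_ ?_ ?_ N ?_
  · intro N _ _ hN e
    exact ⟨1, by
      rw [Submonoid.smul_def]
      exact MExt.smul_eq_zero_of_left (fun a => Subsingleton.elim _ _) i e⟩
  · intro N N' _ _ _ _ e h'
    exact isTorsion'_of_injective p (f := (MExt.preEquiv e Z i).symm.toLinearMap)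
      (MExt.preEquiv e Z i).symm.injective h'
  · intro N₁ N₂ N₃ _ _ _ _ _ _ f g hf hg hfg h₁ h₃
    exact isTorsion'_of_exact p (MExt.pre_exact hf hg hfg Z i) h₃ h₁
  · intro q hq _
    by_cases hqp : q ≤ p
    · obtain rfl : q = p := le_antisymm hqp (hp.2 ⟨hq, bot_le⟩ hqp)
      exact h
    · obtain ⟨s, hsq, hsp⟩ := SetLike.not_le_iff_exists.1 hqp
      refine fun e => ⟨⟨s, hsp⟩, MExt.smul_eq_zero_of_left (x := s) (fun a => ?_) i e⟩
      obtain ⟨r, rfl⟩ := Ideal.Quotient.mk_surjective a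
      exact Ideal.Quotient.eq_zero_iff_mem.2 (q.mul_mem_right r hsq)

lemma exists_quotient_injective [IsNoetherianRing R] (hp : p ∈ minimalPrimes R) (K : Type)
    [AddCommGroup K] [Module R K] [Module.Finite R K] (hK : annihilator R K ≤ p) :
    ∃ f : (R ⧸ p) →ₗ[R] K, Function.Injective f := by
  have : p ∈ (annihilator R K).minimalPrimes :=
    ⟨⟨inferInstance, hK⟩, fun q hq hqp => hp.2 ⟨hq.1, bot_le⟩ hqp⟩
  exact (isAssociatedPrime_iff_exists_injective_linearMap p K).1
    (associatedPrimes.minimalPrimes_annihilator_subset_associatedPrimes R K this) |>.2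

lemma exists_minimalPrimes_of_le_ringKrullDim {d : ℕ} (hdim : ringKrullDim R = d) (I : Ideal R)
    (hI : (d : WithBot ℕ∞) ≤ ringKrullDim (R ⧸ I)) : ∃ p ∈ minimalPrimes R, I ≤ p := by
  obtain ⟨l, hl⟩ := Order.le_krullDim_iff.1 hI
  let f := PrimeSpectrum.comap (Ideal.Quotient.mk I)
  have hf : StrictMono f := RingHom.strictMono_comap_of_surjective Ideal.Quotient.mk_surjective
  let l' := l.map f hf
  refine ⟨l'.head.asIdeal, ⟨⟨l'.head.2, bot_le⟩, fun q hq hle => ?_⟩, ?_⟩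
  · by_contra hne
    have hlt : (⟨q, hq.1⟩ : PrimeSpectrum R) < l'.head := lt_of_le_not_ge hle hne
    have := (Order.LTSeries.length_le_krullDim (l'.cons _ hlt)).trans_eq hdim
    have hlen : (l'.cons _ hlt).length = d + 1 := by simp [l', hl]
    rw [hlen] at this
    exact absurd (WithBot.coe_le_coe.1 this) (by norm_cast; lia)
  · intro x hx
    change Ideal.Quotient.mk I x ∈ l.head.asIdeal
    rw [Ideal.Quotient.eq_zero_iff_mem.2 hx]
    exact zero_mem _

end Torsion

section Kernel

open Module

variable {R : Type} [CommRing R] [IsNoetherianRing R] [IsLocalRing R] {d : ℕ} {ω : Type}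
  [AddCommGroup ω] [Module R ω] (S : CanonicalSetup R d ω)

include S

lemma CanonicalSetup.isTorsion'_succ {p : Ideal R} [p.IsPrime] (hp : p ∈ minimalPrimes R) (i : ℕ)
    (N : Type) [AddCommGroup N] [Module R N] [Module.Finite R N] :
    IsTorsion' (MExt R N ω (i + 1)) p.primeCompl := by
  suffices H : ∀ j i : ℕ, d ≤ i + j → ∀ (N : Type) [AddCommGroup N] [Module R N]
      [Module.Finite R N], IsTorsion' (MExt R N ω (i + 1)) p.primeCompl from H d i (by lia) N
  intro j
  induction j with
  | zero => exact fun i hi N _ _ _ =>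
      isTorsion'_of_subsingleton p (S.subsingleton_ext (i + 1) (by lia) N)
  | succ j ih =>
    intro i hi N _ _ _
    refine MExt.isTorsion'_of_quotient p hp ω (i + 1) ?_ N
    obtain ⟨f, hf⟩ := exists_quotient_injective p hp R
      (by simp [annihilator_eq_bot.2 (inferInstance : FaithfulSMul R R)])
    obtain ⟨δ, hδ, -⟩ := MExt.exists_pre_delta hf (Submodule.mkQ_surjective _)
      (LinearMap.exact_map_mkQ_range f) ω (i + 1)
    exact isTorsion'_of_exact p hδ
      (isTorsion'_of_subsingleton p (MExt.subsingleton_of_projective i))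
      (ih (i + 1) (by lia) _)

/-- A submodule killed by every map into the canonical module has positive codimension. -/
lemma CanonicalSetup.mdim_lt_of_forall_dual {M : Type} [AddCommGroup M] [Module R M]
    [Module.Finite R M] (K : Submodule R M) (hK : ∀ f : M →ₗ[R] ω, ∀ x ∈ K, f x = 0) :
    mdim R K < d := by
  by_contra! hle
  obtain ⟨p, hp, hKp⟩ := exists_minimalPrimes_of_le_ringKrullDim S.ringKrullDim_eq _ hle
  have := hp.1.1
  have := S.finite
  have hKtors : IsTorsion' (MExt R K ω 0) p.primeCompl := by
    obtain ⟨δ, hδ, -⟩ := MExt.exists_pre_delta (Submodule.injective_subtype K)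
      (Submodule.mkQ_surjective _) (LinearMap.exact_subtype_mkQ K) ω 0
    refine isTorsion'_of_injective p (f := δ) ?_ (S.isTorsion'_succ hp 0 _)
    rw [injective_iff_map_eq_zero]
    intro x hx
    obtain ⟨y, rfl⟩ := (hδ x).1 hx
    obtain ⟨f, rfl⟩ := (MExt.zeroEquiv M ω).symm.surjective y
    rw [MExt.pre_zeroEquiv_symm, LinearEquiv.map_eq_zero_iff]
    exact LinearMap.ext fun x => hK f x x.2
  obtain ⟨f, hf⟩ := exists_quotient_injective p hp K hKp
  obtain ⟨δ, hδ, -⟩ := MExt.exists_pre_delta hf (Submodule.mkQ_surjective _)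
    (LinearMap.exact_map_mkQ_range f) ω 0
  have hR := MExt.isTorsion'_of_quotient p hp ω 0
    (isTorsion'_of_exact p hδ hKtors (S.isTorsion'_succ hp 0 _)) R
  obtain ⟨g, hg⟩ := exists_quotient_injective p hp ω fun r hr => by
    rw [S.eq_zero_of_smul_eq_zero (mem_annihilator.1 hr)]
    exact zero_mem p
  have htors : IsTorsion' (R ⧸ p) p.primeCompl := isTorsion'_of_injective p hg
    (isTorsion'_of_injective p
    (f := (MExt.zeroEquiv R ω).symm.toLinearMap ∘ₗ (LinearMap.ringLmapEquivSelf R R ω).symm)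
    ((MExt.zeroEquiv R ω).symm.injective.comp (LinearMap.ringLmapEquivSelf R R ω).symm.injective)
    hR)
  obtain ⟨s, hs⟩ := @htors 1
  refine s.2 (Ideal.Quotient.eq_zero_iff_mem.1 ?_)
  rwa [Submonoid.smul_def, Algebra.smul_def, mul_one] at hs

end Kernel

section Pushout

variable {R : Type} [CommRing R] {A B C Z : Type} [AddCommGroup A] [Module R A]
  [AddCommGroup B] [Module R B] [AddCommGroup C] [Module R C] [AddCommGroup Z] [Module R Z]
  {f : A →ₗ[R] B} {g : B →ₗ[R] C}

/-- The pushout of a short exact sequence along a map out of its first term. -/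
lemma exists_pushout [Module.Finite R B] [Module.Finite R Z] (hf : Function.Injective f)
    (hg : Function.Surjective g) (h : Function.Exact f g) (φ : A →ₗ[R] Z) :
    ∃ (E : Type) (_ : AddCommGroup E) (_ : Module R E) (ι : Z →ₗ[R] E) (j : B →ₗ[R] E)
      (π : E →ₗ[R] C), Module.Finite R E ∧ Function.Injective ι ∧ Function.Surjective π ∧
        Function.Exact ι π ∧ j ∘ₗ f = ι ∘ₗ φ ∧ π ∘ₗ j = g := by
  let S := LinearMap.range ((-φ).prod f)
  have hS : S ≤ LinearMap.ker (g ∘ₗ LinearMap.snd R Z B) := by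
    rintro _ ⟨a, rfl⟩
    exact h.apply_apply_eq_zero a
  refine ⟨(Z × B) ⧸ S, inferInstance, inferInstance, S.mkQ ∘ₗ LinearMap.inl R Z B,
    S.mkQ ∘ₗ LinearMap.inr R Z B, S.liftQ _ hS, inferInstance, ?_, ?_, ?_, ?_, ?_⟩
  · rw [injective_iff_map_eq_zero]
    intro z hz
    obtain ⟨a, ha⟩ := (Submodule.Quotient.mk_eq_zero S).1 hz
    obtain ⟨h₁, h₂⟩ := Prod.ext_iff.1 ha
    obtain rfl : a = 0 := hf (h₂.trans (map_zero f).symm)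
    simpa using h₁.symm
  · intro c
    obtain ⟨b, rfl⟩ := hg c
    exact ⟨S.mkQ (0, b), rfl⟩
  · intro e
    obtain ⟨⟨z, b⟩, rfl⟩ := S.mkQ_surjective e
    refine ⟨fun hb => ?_, ?_⟩
    · obtain ⟨a, rfl⟩ := (h b).1 hb
      exact ⟨z + φ a, (Submodule.Quotient.eq S).2 ⟨-a, by simp⟩⟩
    · rintro ⟨z', hz'⟩
      rw [← hz']
      exact map_zero g
  · ext a
    exact (Submodule.Quotient.eq S).2 ⟨a, by simp⟩
  · ext b
    rfl

/-- `Ext^1` of the cokernel vanishes as soon as maps extend along one presentation. -/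
lemma MExt.subsingleton_one_of_surjective [Module.Projective R B] (hf : Function.Injective f)
    (hg : Function.Surjective g) (h : Function.Exact f g)
    (H : ∀ φ : A →ₗ[R] Z, ∃ ψ : B →ₗ[R] Z, ψ ∘ₗ f = φ) : Subsingleton (MExt R C Z 1) := by
  obtain ⟨δ, hδ, hδ'⟩ := MExt.exists_pre_delta hf hg h Z 0
  refine subsingleton_of_forall_eq 0 fun x => ?_
  obtain ⟨y, rfl⟩ := (hδ' x).1 ((MExt.subsingleton_of_projective 0).elim _ _)
  obtain ⟨φ, rfl⟩ := (MExt.zeroEquiv A Z).symm.surjective y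
  obtain ⟨ψ, rfl⟩ := H φ
  rw [← MExt.pre_zeroEquiv_symm]
  exact hδ.apply_apply_eq_zero _

end Pushout

section Envelope

open IsLocalRing

variable {R : Type} [CommRing R] [IsLocalRing R] {d : ℕ}

lemma isMCM_iff (Z : Type) [AddCommGroup Z] [Module R Z] :
    IsMCM R d Z ↔ Module.Finite R Z ∧ DepthGE R d Z :=
  and_congr_right fun _ => le_rdepth_iff d Z

variable {M X : Type} [AddCommGroup M] [Module R M] [AddCommGroup X] [Module R X]
  {μ : M →ₗ[R] X}

/-- Wakamatsu's lemma for maximal Cohen-Macaulay envelopes. -/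
lemma IsCMEnvelope.subsingleton_mExt [IsNoetherianRing R] (hμ : IsCMEnvelope R d μ) (Z : Type)
    [AddCommGroup Z] [Module R Z] (hZ : IsMCM R d Z) :
    Subsingleton (MExt R (X ⧸ LinearMap.range μ) Z 1) := by
  obtain ⟨⟨hX, hpre⟩, henv⟩ := hμ
  have hX' := (isMCM_iff X).1 hX
  have hZ' := (isMCM_iff Z).1 hZ
  have := hX'.1
  have := hZ'.1
  obtain ⟨m, p, hp⟩ := Module.Finite.exists_fin' R X
  let q := (LinearMap.range μ).mkQ ∘ₗ p
  have hq : Function.Surjective q := (Submodule.mkQ_surjective _).comp hp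
  refine MExt.subsingleton_one_of_surjective (Submodule.injective_subtype (LinearMap.ker q)) hq
    (LinearMap.exact_subtype_ker_map q) fun h => ?_
  have hle : LinearMap.ker p ≤ LinearMap.ker q := LinearMap.ker_le_ker_comp _ _
  obtain ⟨E, _, _, ι, j, π, hE, hι, hπ, hex, hj, hπj⟩ := exists_pushout
    (Submodule.injective_subtype (LinearMap.ker p)) hp (LinearMap.exact_subtype_ker_map p)
    (h ∘ₗ Submodule.inclusion hle)
  have hEmcm : IsMCM R d E := (isMCM_iff E).2 ⟨hE, fun i hi =>
    MExt.subsingleton_middle_right hι hπ hex (hZ'.2 i hi) (hX'.2 i hi)⟩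
  obtain ⟨u, hu⟩ : ∃ u : M →ₗ[R] E, ∀ (x : LinearMap.ker q) (a : M), p x = μ a →
      u a = j x - ι (h x) := by
    let w : LinearMap.ker q →ₗ[R] E := j ∘ₗ (LinearMap.ker q).subtype - ι ∘ₗ h
    have hr : ∀ x : LinearMap.ker q, p x ∈ LinearMap.range μ := fun x =>
      (Submodule.Quotient.mk_eq_zero _).1 x.2
    let r : LinearMap.ker q →ₗ[R] LinearMap.range μ :=
      (p ∘ₗ (LinearMap.ker q).subtype).codRestrict _ hr
    have hrs : Function.Surjective r := by
      rintro ⟨y, hy⟩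
      obtain ⟨x, rfl⟩ := hp y
      exact ⟨⟨x, (Submodule.Quotient.mk_eq_zero _).2 hy⟩, rfl⟩
    have hrw : LinearMap.ker r ≤ LinearMap.ker w := by
      intro x hx
      have hx' : p x = 0 := congrArg Subtype.val hx
      have := LinearMap.congr_fun hj ⟨x, hx'⟩
      exact sub_eq_zero.2 this
    refine ⟨(LinearMap.ker r).liftQ w hrw ∘ₗ (r.quotKerEquivOfSurjective hrs).symm ∘ₗ
      μ.rangeRestrict, fun x a hxa => ?_⟩
    have : (r.quotKerEquivOfSurjective hrs).symm (μ.rangeRestrict a) =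
        (LinearMap.ker r).mkQ x := by
      rw [LinearEquiv.symm_apply_eq]
      exact Subtype.ext hxa.symm
    simp [this, w]
  have hπu : π ∘ₗ u = μ := by
    ext a
    obtain ⟨x, hx⟩ := hp (μ a)
    have hxq : x ∈ LinearMap.ker q := (Submodule.Quotient.mk_eq_zero _).2 ⟨a, hx.symm⟩
    rw [LinearMap.comp_apply, hu ⟨x, hxq⟩ a hx, map_sub, hex.apply_apply_eq_zero, sub_zero, ← hx]
    exact LinearMap.congr_fun hπj x
  obtain ⟨v, hv⟩ := hpre E hEmcm u
  have hbij := henv (π ∘ₗ v) (by rw [LinearMap.comp_assoc, hv, hπu])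
  let e := LinearEquiv.ofBijective _ hbij
  let σ := v ∘ₗ e.symm.toLinearMap
  have hπσ : ∀ x, π (σ x) = x := fun x => e.apply_symm_apply x
  have hσ : ∀ a, σ (μ a) = u a := by
    intro a
    have : e.symm (μ a) = μ a := by
      rw [LinearEquiv.symm_apply_eq]
      exact (LinearMap.congr_fun (hv ▸ hπu : π ∘ₗ v ∘ₗ μ = μ) a).symm
    change v (e.symm (μ a)) = _
    rw [this, ← hv]
    rfl
  have hrange : ∀ y, (j - σ ∘ₗ p) y ∈ LinearMap.range ι := fun y =>
    (hex _).1 (by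
      rw [LinearMap.sub_apply, map_sub, LinearMap.comp_apply, hπσ, ← hπj, LinearMap.comp_apply,
        sub_self])
  let ψ := (LinearEquiv.ofInjective ι hι).symm.toLinearMap ∘ₗ (j - σ ∘ₗ p).codRestrict _ hrange
  have hψ : ∀ y, ι (ψ y) = j y - σ (p y) := fun y =>
    congrArg Subtype.val ((LinearEquiv.ofInjective ι hι).apply_symm_apply
      ((j - σ ∘ₗ p).codRestrict _ hrange y))
  refine ⟨ψ, LinearMap.ext fun x => hι ?_⟩
  obtain ⟨a, ha⟩ := (Submodule.Quotient.mk_eq_zero _).1 x.2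
  rw [LinearMap.comp_apply, hψ, Submodule.subtype_apply, ← ha, hσ, hu x a ha.symm, sub_sub_cancel]

variable [IsNoetherianRing R] {ω : Type} [AddCommGroup ω] [Module R ω] (S : CanonicalSetup R d ω)

include S

lemma CanonicalSetup.noNonzeroFreeSummand (hμ : IsCMEnvelope R d μ) :
    NoNonzeroFreeSummand R
      (((X →ₗ[R] ω) →ₗ[R] ω) ⧸ LinearMap.range (dmap R ω (dmap R ω μ))) := by
  intro F G hFG hF
  obtain ⟨⟨hX, hpre⟩, henv⟩ := hμ
  have hX' := (isMCM_iff X).1 hX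
  have := hX'.1
  let q := F.projectionOnto G hFG ∘ₗ Submodule.mkQ _ ∘ₗ deltaMap R ω X
  have hq : Function.Surjective q := (Submodule.projectionOnto_surjective hFG).comp
    ((Submodule.mkQ_surjective _).comp (S.deltaMap_surjective X hX'.2))
  have hqμ : ∀ a, q (μ a) = 0 := fun a => by
    have : Submodule.mkQ (LinearMap.range (dmap R ω (dmap R ω μ))) (deltaMap R ω X (μ a)) = 0 :=
      (Submodule.Quotient.mk_eq_zero _).2 ⟨deltaMap R ω M a, rfl⟩
    simp only [q, LinearMap.comp_apply, this, map_zero]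
  obtain ⟨s, hs⟩ := Module.projective_lifting_property q LinearMap.id hq
  have hinj := (henv (LinearMap.id - s ∘ₗ q) (LinearMap.ext fun a => by simp [hqμ])).1
  rw [eq_bot_iff]
  intro y hy
  have hsy : s ⟨y, hy⟩ = 0 := hinj (by
    have := LinearMap.congr_fun hs ⟨y, hy⟩
    simp only [LinearMap.comp_apply] at this
    simp [this])
  have := LinearMap.congr_fun hs ⟨y, hy⟩
  rw [LinearMap.comp_apply, hsy, map_zero] at this
  exact congrArg Subtype.val this.symm

lemma CanonicalSetup.codGT_ker [Module.Finite R M] (hμ : IsCMEnvelope R d μ) :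
    codGT R d (LinearMap.ker μ) 0 := by
  have := S.finite
  rw [codGT, Nat.cast_zero, add_zero]
  refine S.mdim_lt_of_forall_dual _ fun f x hx => ?_
  obtain ⟨g, rfl⟩ := hμ.1.2 ω ((isMCM_iff ω).2 ⟨S.finite, S.depthGE⟩) f
  rw [LinearMap.comp_apply, LinearMap.mem_ker.1 hx, map_zero]

omit S in
lemma isCMPreenvelope_of_subsingleton [Module.Finite R M] (hX : IsMCM R d X)
    (hker : codGT R d (LinearMap.ker μ) 0)
    (hext : ∀ (Z : Type) [AddCommGroup Z] [Module R Z], IsMCM R d Z →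
      Subsingleton (MExt R (X ⧸ LinearMap.range μ) Z 1)) : IsCMPreenvelope R d μ := by
  refine ⟨hX, fun Z _ _ hZ f => ?_⟩
  obtain ⟨_, hZd⟩ := (isMCM_iff Z).1 hZ
  rw [codGT, Nat.cast_zero, add_zero] at hker
  have := hZd.subsingleton_linearMap (LinearMap.ker μ) hker
  have hle : LinearMap.ker μ ≤ LinearMap.ker f := fun x hx =>
    LinearMap.congr_fun (Subsingleton.elim (f ∘ₗ (LinearMap.ker μ).subtype) 0) ⟨x, hx⟩
  obtain ⟨g, hg⟩ := exists_extension_of_subsingleton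
    (Submodule.injective_subtype (LinearMap.range μ)) (Submodule.mkQ_surjective _)
    (LinearMap.exact_subtype_mkQ _) (hext Z hZ)
    ((LinearMap.ker μ).liftQ f hle ∘ₗ μ.quotKerEquivRange.symm)
  refine ⟨g, LinearMap.ext fun a => ?_⟩
  have : μ.quotKerEquivRange.symm ⟨μ a, a, rfl⟩ = (LinearMap.ker μ).mkQ a := by
    rw [LinearEquiv.symm_apply_eq]
    rfl
  have h' := LinearMap.congr_fun hg ⟨μ a, a, rfl⟩
  simp only [LinearMap.comp_apply, LinearEquiv.coe_coe, this] at h'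
  exact h'

omit S [IsLocalRing R] [IsNoetherianRing R] in
/-- A module with a surjection onto the base ring has a nonzero free direct summand. -/
lemma NoNonzeroFreeSummand.not_surjective [Nontrivial R] {Q : Type} [AddCommGroup Q] [Module R Q]
    (hQ : NoNonzeroFreeSummand R Q) (l : Q →ₗ[R] R) : ¬ Function.Surjective l := by
  intro hl
  obtain ⟨y, hy⟩ := hl 1
  let s := LinearMap.toSpanSingleton R Q y
  have hls : ∀ r, l (s r) = r := fun r => by simp [s, hy]
  have hs : Function.Injective s := Function.LeftInverse.injective hls
  let e := LinearEquiv.ofInjective s hs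
  have hc := LinearMap.isCompl_of_proj (p := LinearMap.range s) (f := e.toLinearMap ∘ₗ l) (by
    rintro ⟨_, r, rfl⟩
    simp only [LinearMap.comp_apply, hls]
    rfl)
  have h0 := hQ _ _ hc (Module.Free.of_equiv e)
  have hy0 : y = 0 := by
    have : s 1 ∈ LinearMap.range s := ⟨1, rfl⟩
    rw [h0] at this
    simpa [s] using this
  rw [hy0, map_zero] at hy
  exact zero_ne_one hy

lemma CanonicalSetup.not_surjective_of_comp_eq_zero (hX : IsMCM R d X)
    (hQ : NoNonzeroFreeSummand R
      (((X →ₗ[R] ω) →ₗ[R] ω) ⧸ LinearMap.range (dmap R ω (dmap R ω μ))))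
    (l : X →ₗ[R] R) (hl : l ∘ₗ μ = 0) : ¬ Function.Surjective l := by
  intro hsurj
  obtain ⟨_, hXd⟩ := (isMCM_iff X).1 hX
  let e := LinearEquiv.ofBijective _ (S.deltaMap_bijective X hXd)
  refine hQ.not_surjective (Submodule.liftQ _ (l ∘ₗ e.symm.toLinearMap) ?_) fun r => ?_
  · rintro _ ⟨θ, rfl⟩
    obtain ⟨x, hx⟩ := e.surjective (dmap R ω (dmap R ω μ) θ)
    rw [← hx, LinearMap.mem_ker]
    simp only [LinearMap.comp_apply, LinearEquiv.coe_coe, LinearEquiv.symm_apply_apply]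
    refine S.eq_zero_of_smul_eq_zero fun w => ?_
    have h0 : (LinearMap.toSpanSingleton R ω w ∘ₗ l) ∘ₗ μ = 0 := by
      rw [LinearMap.comp_assoc, hl, LinearMap.comp_zero]
    have := LinearMap.congr_fun hx (LinearMap.toSpanSingleton R ω w ∘ₗ l)
    change l x • w = θ ((LinearMap.toSpanSingleton R ω w ∘ₗ l) ∘ₗ μ) at this
    rw [this, h0, map_zero]
  · obtain ⟨x, rfl⟩ := hsurj r
    exact ⟨Submodule.mkQ _ (e x), congrArg l (e.symm_apply_apply x)⟩

lemma CanonicalSetup.isCMEnvelope (hpre : IsCMPreenvelope R d μ)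
    (hext : ∀ (Z : Type) [AddCommGroup Z] [Module R Z], IsMCM R d Z →
      Subsingleton (MExt R (X ⧸ LinearMap.range μ) Z 1))
    (hQ : NoNonzeroFreeSummand R
      (((X →ₗ[R] ω) →ₗ[R] ω) ⧸ LinearMap.range (dmap R ω (dmap R ω μ)))) :
    IsCMEnvelope R d μ := by
  refine ⟨hpre, fun φ hφ => ?_⟩
  obtain ⟨_, hXd⟩ := (isMCM_iff X).1 hpre.1
  obtain ⟨m, g, hg, hK⟩ := S.depthGE_ring.exists_cover X hXd
  have hψ : LinearMap.range μ ≤ LinearMap.ker (LinearMap.id - φ) := by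
    rintro _ ⟨a, rfl⟩
    exact sub_eq_zero.2 (LinearMap.congr_fun hφ a).symm
  obtain ⟨h, hh⟩ := exists_lift_of_subsingleton (Submodule.injective_subtype _) hg
    (LinearMap.exact_subtype_ker_map g)
    (hext (LinearMap.ker g) ((isMCM_iff _).2 ⟨inferInstance, hK⟩)) (Submodule.liftQ _ _ hψ)
  have hmem : ∀ x i, h (Submodule.mkQ _ x) i ∈ maximalIdeal R := by
    intro x i
    by_contra hu
    refine S.not_surjective_of_comp_eq_zero hpre.1 hQ
      (LinearMap.proj i ∘ₗ h ∘ₗ Submodule.mkQ _) ?_ ?_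
    · ext a
      have : (LinearMap.range μ).mkQ (μ a) = 0 := (Submodule.Quotient.mk_eq_zero _).2 ⟨a, rfl⟩
      simp only [LinearMap.comp_apply, this, map_zero, LinearMap.zero_apply]
    · intro r
      obtain ⟨u, hu⟩ := notMem_maximalIdeal.1 hu
      refine ⟨(r * (u⁻¹ : Rˣ)) • x, ?_⟩
      rw [map_smul]
      change (r * (u⁻¹ : Rˣ)) • h (Submodule.mkQ _ x) i = r
      rw [← hu, smul_eq_mul, mul_assoc, Units.inv_mul, mul_one]
  refine IsNoetherian.bijective_of_surjective_endomorphism φ (LinearMap.range_eq_top.1 ?_)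
  rw [eq_top_iff]
  refine Submodule.le_of_le_smul_of_le_jacobson_bot Module.Finite.fg_top
    (maximalIdeal_le_jacobson _) fun x _ => ?_
  have hx : x = φ x + g (h (Submodule.mkQ _ x)) := by
    have : g (h (Submodule.mkQ _ x)) = x - φ x := LinearMap.congr_fun hh (Submodule.mkQ _ x)
    rw [this, add_sub_cancel]
  rw [hx]
  refine Submodule.add_mem_sup ⟨x, rfl⟩ ?_
  rw [← Finset.univ_sum_single (h (Submodule.mkQ _ x)), map_sum]
  refine Submodule.sum_mem _ fun i _ => ?_
  rw [← mul_one (h (Submodule.mkQ _ x) i), ← smul_eq_mul, Pi.single_smul, map_smul]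
  exact Submodule.smul_mem_smul (hmem x i) trivial

end Envelope

/-- over a Henselian CM local ring, `μ : M → X` with `X` maximal Cohen-Macaulay
is a CM-envelope iff `cod (ker μ) > 0`, `Ext^1(coker μ, Z) = 0` for every maximal
Cohen-Macaulay `Z`, and `coker (μ†† : M†† → X††)` has no nonzero free direct summand. -/
theorem cm_envelope_iff (R : Type) [CommRing R] [IsNoetherianRing R] [HenselianLocalRing R]
    (d : ℕ) (hdim : ringKrullDim R = d) (hCM : (d : ℕ∞) ≤ rdepth R R)
    (ω : Type) [AddCommGroup ω] [Module R ω] (hω : IsCanonicalModule R d ω)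
    (M X : Type) [AddCommGroup M] [Module R M] [AddCommGroup X] [Module R X]
    [Module.Finite R M] (hX : IsMCM R d X) (μ : M →ₗ[R] X) :
    IsCMEnvelope R d μ ↔
      codGT R d ↥(LinearMap.ker μ) 0 ∧
        (∀ (Z : Type) [AddCommGroup Z] [Module R Z], IsMCM R d Z →
          Subsingleton (ext1 R 1 (X ⧸ LinearMap.range μ) Z)) ∧
        NoNonzeroFreeSummand R
          (((X →ₗ[R] ω) →ₗ[R] ω) ⧸ LinearMap.range (dmap R ω (dmap R ω μ))) := by
  have S := hω.canonicalSetup hdim hCM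
  have hext : (∀ (Z : Type) [AddCommGroup Z] [Module R Z], IsMCM R d Z →
      Subsingleton (ext1 R 1 (X ⧸ LinearMap.range μ) Z)) ↔
      ∀ (Z : Type) [AddCommGroup Z] [Module R Z], IsMCM R d Z →
        Subsingleton (MExt R (X ⧸ LinearMap.range μ) Z 1) :=
    forall₄_congr fun Z _ _ _ => (extEquivMExt _ Z 1).toEquiv.subsingleton_congr
  rw [hext]
  constructor
  · intro hμ
    exact ⟨S.codGT_ker hμ, hμ.subsingleton_mExt, S.noNonzeroFreeSummand hμ⟩
  · rintro ⟨hker, hZ, hQ⟩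
    exact S.isCMEnvelope (isCMPreenvelope_of_subsingleton hX hker hZ) hZ hQ
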